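/- arXiv:math/0111321 — 2 statements merged into one kernel-verified Lean document; each statement's English description precedes it below -/
import Mathlib

section
/- Let |u − u*| and |v| = |(v₁,…,vₙ)| be sufficiently small. Then for all (z, Υ) ∈ ℝⁿ × ℝⁿ the system of 2n equations z = Σ_i h_i · r̃_i(u, v_i, λ_i* − θ(g_i/h_i)), Υ = Σ_i (g_i − λ_i* h_i) · r̃_i(u, v_i, λ_i* − θ(g_i/h_i)) (with the convention r̃_i = r_i(u) when h_i = g_i = 0) has a unique solution (h, g) = (h₁,…,hₙ, g₁,…,gₙ). The map (z, Υ) ↦ (h, g) is Lipschitz continuous on the whole space ℝ²ⁿ, and it is smooth outside the n manifolds N̂_i := {h_i = g_i = 0}. -/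
open MeasureTheory Filter Topology Set
open scoped ENNReal NNReal

noncomputable section

/-- The map `Λ̂` of the perturbation decomposition:
`Λ̂(h,g) = ( Σ_i h_i r̃_i(u, v_i, λ_i* − θ(g_i/h_i)),
            Σ_i (g_i − λ_i* h_i) r̃_i(u, v_i, λ_i* − θ(g_i/h_i)) )`.
(Lean's convention `g/0 = 0` together with `r̃_i(u,0,σ) = r_i(u)` implements the convention
`r̃_i = r_i(u)` when `h_i = g_i = 0`.) -/
def LamHat {n : ℕ} (lamstar : Fin n → ℝ) (θ : ℝ → ℝ)
    (rt : Fin n → (Fin n → ℝ) → ℝ → ℝ → (Fin n → ℝ))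
    (u : Fin n → ℝ) (v : Fin n → ℝ) (hg : (Fin n → ℝ) × (Fin n → ℝ)) :
    (Fin n → ℝ) × (Fin n → ℝ) :=
  (∑ i, hg.1 i • rt i u (v i) (lamstar i - θ (hg.2 i / hg.1 i)),
   ∑ i, (hg.2 i - lamstar i * hg.1 i) • rt i u (v i) (lamstar i - θ (hg.2 i / hg.1 i)))

section

variable {E F : Type*} [NormedAddCommGroup E] [NormedSpace ℝ E]
  [NormedAddCommGroup F] [NormedSpace ℝ F]

theorem ApproximatesLinearOn.of_hasFDerivAt {f : E → F} {L f' : E →L[ℝ] F} {c : ℝ≥0}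
    (hf : ApproximatesLinearOn f L univ c) {x : E} (hx : HasFDerivAt f f' x) :
    ApproximatesLinearOn f' L univ c := by
  have hlip : LipschitzWith c (f - ⇑L) :=
    lipschitzOnWith_univ.1 (approximatesLinearOn_iff_lipschitzOnWith.1 hf)
  have hle : ‖f' - L‖ ≤ c := (hx.sub L.hasFDerivAt).le_of_lipschitz hlip
  intro y _ z _
  rw [← map_sub, ← sub_apply]
  exact (f' - L).le_of_opNorm_le hle _

theorem ApproximatesLinearOn.contDiffAt_toHomeomorph_symm [CompleteSpace E] {f : E → F}
    {L : E ≃L[ℝ] F} {c : ℝ≥0}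
    {k : WithTop ℕ∞} (hk : k ≠ 0) (hf : ApproximatesLinearOn f (L : E →L[ℝ] F) univ c)
    (hc : Subsingleton E ∨ c < ‖(L.symm : F →L[ℝ] E)‖₊⁻¹) {y : F}
    (hy : ContDiffAt ℝ k f ((hf.toHomeomorph f hc).symm y)) :
    ContDiffAt ℝ k (hf.toHomeomorph f hc).symm y := by
  have hd := (hy.differentiableAt hk).hasFDerivAt
  set f' := fderiv ℝ f ((hf.toHomeomorph f hc).symm y)
  let e := (hf.of_hasFDerivAt hd).toHomeomorph f' hc
  let L' : E ≃L[ℝ] F :=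
    { LinearEquiv.ofBijective (f' : E →ₗ[ℝ] F) e.bijective with
      continuous_toFun := f'.continuous
      continuous_invFun := by
        convert e.symm.continuous using 1
        ext z
        apply e.injective
        rw [e.apply_symm_apply]
        exact (LinearEquiv.ofBijective (f' : E →ₗ[ℝ] F) e.bijective).apply_symm_apply z }
  have hL' : (L' : E →L[ℝ] F) = f' := by ext x; rfl
  exact (hf.toHomeomorph f hc).toOpenPartialHomeomorph.contDiffAt_symm (f₀' := L') (mem_univ y)
    (by rw [hL']; exact hd) hy

end

theorem norm_le_of_lipschitz_of_support {E : Type*} [NormedAddCommGroup E] {p : ℝ → E} {κ M : ℝ}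
    (hκ : 0 ≤ κ) (hM : 0 < M)
    (hp : ∀ s t, ‖p s - p t‖ ≤ κ * |s - t|) (hp0 : ∀ s, M ≤ |s| → p s = 0) (s : ℝ) :
    ‖p s‖ ≤ 2 * M * κ := by
  rcases le_total M |s| with h | h
  · rw [hp0 s h, norm_zero]; positivity
  · have h1 := hp s M
    rw [hp0 M (le_abs_self M), sub_zero] at h1
    have h2 : |s - M| ≤ 2 * M := by
      rw [abs_le] at h ⊢; constructor <;> linarith
    nlinarith [mul_le_mul_of_nonneg_left h2 hκ]

section

variable {E : Type*} [NormedAddCommGroup E] [NormedSpace ℝ E]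

theorem norm_homogeneous_sub_le {p : ℝ → E} {κ M : ℝ} (hκ : 0 ≤ κ) (hM : 0 < M)
    (hp : ∀ s t, ‖p s - p t‖ ≤ κ * |s - t|) (hp0 : ∀ s, M ≤ |s| → p s = 0) (h g h' g' : ℝ) :
    ‖h • p (g / h) - h' • p (g' / h')‖ ≤ κ * (3 * M * |h - h'| + |g - g'|) := by
  have hb := norm_le_of_lipschitz_of_support hκ hM hp hp0
  have main : ∀ h g h' g' : ℝ, h ≠ 0 → h' ≠ 0 → |g / h| < M →
      ‖h • p (g / h) - h' • p (g' / h')‖ ≤ κ * (3 * M * |h - h'| + |g - g'|) := by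
    intro h g h' g' hh hh' hM'
    have e1 : h • p (g / h) - h' • p (g' / h')
        = (h - h') • p (g / h) + h' • (p (g / h) - p (g' / h')) := by
      simp only [sub_smul, smul_sub]; abel
    have e2 : |h'| * |g / h - g' / h'| ≤ M * |h - h'| + |g - g'| := by
      rw [← abs_mul]
      have : h' * (g / h - g' / h') = -((g / h) * (h - h')) + (g - g') := by field_simp; ring
      rw [this]
      refine (abs_add_le _ _).trans ?_
      rw [abs_neg, abs_mul]
      gcongr
    rw [e1]
    refine (norm_add_le _ _).trans ?_
    rw [norm_smul, norm_smul, Real.norm_eq_abs, Real.norm_eq_abs]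
    have i1 := mul_le_mul_of_nonneg_left (hb (g / h)) (abs_nonneg (h - h'))
    have i2 := mul_le_mul_of_nonneg_left (hp (g / h) (g' / h')) (abs_nonneg h')
    have i3 := mul_le_mul_of_nonneg_left e2 hκ
    linarith
  have hnn : ∀ a b : ℝ, κ * (2 * M * |a|) ≤ κ * (3 * M * |a| + |b|) := fun a b => by
    have := mul_nonneg hM.le (abs_nonneg a)
    have := abs_nonneg b
    exact mul_le_mul_of_nonneg_left (by linarith) hκ
  by_cases hh : h = 0
  · subst hh
    rw [zero_smul, zero_sub, norm_neg, norm_smul, Real.norm_eq_abs]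
    refine le_trans ?_ (hnn _ _)
    rw [zero_sub, abs_neg]
    linarith [mul_le_mul_of_nonneg_left (hb (g' / h')) (abs_nonneg h')]
  by_cases hh' : h' = 0
  · subst hh'
    rw [zero_smul, sub_zero, norm_smul, Real.norm_eq_abs]
    refine le_trans ?_ (hnn _ _)
    rw [sub_zero]
    linarith [mul_le_mul_of_nonneg_left (hb (g / h)) (abs_nonneg h)]
  rcases lt_or_ge |g / h| M with h1 | h1
  · exact main h g h' g' hh hh' h1
  rcases lt_or_ge |g' / h'| M with h2 | h2
  · rw [norm_sub_rev, abs_sub_comm h, abs_sub_comm g]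
    exact main h' g' h g hh' hh h2
  · rw [hp0 _ h1, hp0 _ h2, smul_zero, smul_zero, sub_zero, norm_zero]
    positivity

theorem norm_id_smul_sub_le {p : ℝ → E} {κ M : ℝ} (hκ : 0 ≤ κ) (hM : 0 < M)
    (hp : ∀ s t, ‖p s - p t‖ ≤ κ * |s - t|) (hp0 : ∀ s, M ≤ |s| → p s = 0) (s t : ℝ) :
    ‖s • p s - t • p t‖ ≤ 3 * M * κ * |s - t| := by
  have hb := norm_le_of_lipschitz_of_support hκ hM hp hp0
  have main : ∀ s t : ℝ, |s| < M → ‖s • p s - t • p t‖ ≤ 3 * M * κ * |s - t| := by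
    intro s t hs
    have e1 : s • p s - t • p t = (s - t) • p t + s • (p s - p t) := by
      simp only [sub_smul, smul_sub]; abel
    rw [e1]
    refine (norm_add_le _ _).trans ?_
    rw [norm_smul, norm_smul, Real.norm_eq_abs, Real.norm_eq_abs]
    have i1 := mul_le_mul_of_nonneg_left (hb t) (abs_nonneg (s - t))
    have i2 := mul_le_mul hs.le (hp s t) (norm_nonneg _) hM.le
    linarith
  rcases lt_or_ge |s| M with h1 | h1
  · exact main s t h1
  rcases lt_or_ge |t| M with h2 | h2
  · rw [norm_sub_rev, abs_sub_comm]; exact main t s h2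
  · rw [hp0 _ h1, hp0 _ h2, smul_zero, smul_zero, sub_zero, norm_zero]
    positivity

theorem norm_smul_div_sub_le {p : ℝ → E} {κ M : ℝ} (hκ : 0 ≤ κ) (hM : 0 < M)
    (hp : ∀ s t, ‖p s - p t‖ ≤ κ * |s - t|) (hp0 : ∀ s, M ≤ |s| → p s = 0) (hpz : p 0 = 0)
    (h g h' g' : ℝ) :
    ‖g • p (g / h) - g' • p (g' / h')‖ ≤ 3 * M * κ * (3 * M * |h - h'| + |g - g'|) := by
  have key : ∀ h g : ℝ, g • p (g / h) = h • ((g / h) • p (g / h)) := by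
    intro h g
    by_cases hh : h = 0
    · simp [hh, hpz]
    · rw [smul_smul, mul_div_cancel₀ _ hh]
  rw [key h g, key h' g']
  exact norm_homogeneous_sub_le (p := fun s => s • p s) (by positivity) hM
    (norm_id_smul_sub_le hκ hM hp hp0) (fun s hs => by simp [hp0 s hs]) h g h' g'

theorem norm_decomposition_term_sub_le {R : ℝ → E} {b r₀ : E} {η M lam D : ℝ} (hη : 0 ≤ η)
    (hM : 0 < M) (hp : ∀ s t, ‖R s - R t‖ ≤ η * |s - t|) (hp0 : ∀ s, M ≤ |s| → R s = b)
    (hpz : R 0 = b) (hb : ‖b - r₀‖ ≤ η) {h g h' g' : ℝ} (hh : |h - h'| ≤ D) (hg : |g - g'| ≤ D) :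
    ‖h • R (g / h) - h' • R (g' / h') - (h - h') • r₀‖ ≤
        η * ((3 * M + 1) * (1 + 3 * M + |lam|) + (1 + |lam|)) * D ∧
    ‖(g - lam * h) • R (g / h) - (g' - lam * h') • R (g' / h')
        - ((g - g') - lam * (h - h')) • r₀‖ ≤
        η * ((3 * M + 1) * (1 + 3 * M + |lam|) + (1 + |lam|)) * D := by
  have hD : 0 ≤ D := (abs_nonneg _).trans hh
  have hp' : ∀ s t, ‖(R s - b) - (R t - b)‖ ≤ η * |s - t| := fun s t => by
    rw [sub_sub_sub_cancel_right]; exact hp s t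
  have hp0' : ∀ s, M ≤ |s| → R s - b = 0 := fun s hs => by rw [hp0 s hs, sub_self]
  have hbd : η * (3 * M * |h - h'| + |g - g'|) ≤ η * ((3 * M + 1) * D) := by
    have := mul_le_mul_of_nonneg_left hh (by positivity : 0 ≤ 3 * M)
    exact mul_le_mul_of_nonneg_left (by linarith) hη
  have i1 := (norm_homogeneous_sub_le (p := fun s => R s - b) hη hM hp' hp0' h g h' g').trans hbd
  have i2 := norm_smul_div_sub_le (p := fun s => R s - b) hη hM hp' hp0'
    (by rw [hpz, sub_self]) h g h' g'
  have i2' : 3 * M * η * (3 * M * |h - h'| + |g - g'|) ≤ 3 * M * (η * ((3 * M + 1) * D)) := by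
    rw [mul_assoc (3 * M) η]
    exact mul_le_mul_of_nonneg_left hbd (by positivity)
  replace i2 := i2.trans i2'
  have hl : 0 ≤ |lam| := abs_nonneg lam
  set X := h • (R (g / h) - b) - h' • (R (g' / h') - b)
  set Y := g • (R (g / h) - b) - g' • (R (g' / h') - b)
  constructor
  · have e : h • R (g / h) - h' • R (g' / h') - (h - h') • r₀ = X + (h - h') • (b - r₀) := by
      simp only [X, sub_smul, smul_sub]; abel
    rw [e]
    refine (norm_add_le _ _).trans ?_
    rw [norm_smul, Real.norm_eq_abs]
    have i3 := mul_le_mul hh hb (norm_nonneg _) hD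
    have : 0 ≤ η * D * ((3 * M + 1) * (3 * M + |lam|) + |lam|) := by positivity
    nlinarith
  · have e : (g - lam * h) • R (g / h) - (g' - lam * h') • R (g' / h')
        - ((g - g') - lam * (h - h')) • r₀
        = Y - lam • X + ((g - g') - lam * (h - h')) • (b - r₀) := by
      simp only [X, Y]; module
    rw [e]
    refine (norm_add_le _ _).trans ?_
    have i4 := norm_sub_le Y (lam • X)
    rw [norm_smul, Real.norm_eq_abs] at i4 ⊢
    have i5 := mul_le_mul_of_nonneg_left i1 hl
    have i6 : |(g - g') - lam * (h - h')| ≤ (1 + |lam|) * D := by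
      refine (abs_sub _ _).trans ?_
      rw [abs_mul]
      linarith [mul_le_mul_of_nonneg_left hh hl]
    have i7 := mul_le_mul i6 hb (norm_nonneg _) (by positivity)
    have : 0 ≤ η * D * (3 * M + 1) := by positivity
    nlinarith

end

theorem linearIndependent_of_strictMono_eigenvalues {n : ℕ}
    {A : (Fin n → ℝ) →L[ℝ] (Fin n → ℝ)} {μ : Fin n → ℝ} {r : Fin n → (Fin n → ℝ)}
    (hμ : StrictMono μ) (hr : ∀ i, ‖r i‖ = 1 ∧ A (r i) = μ i • r i) :
    LinearIndependent ℝ r := by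
  refine Module.End.eigenvectors_linearIndependent' (A : (Fin n → ℝ) →ₗ[ℝ] (Fin n → ℝ)) μ
    hμ.injective r fun i => ⟨?_, ?_⟩
  · rw [Module.End.mem_eigenspace_iff]
    exact (hr i).2
  · intro h0
    have := (hr i).1
    rw [h0, norm_zero] at this
    exact zero_ne_one this

/-- The decomposition `(h, g) ↦ (Σ h_i r_i, Σ (g_i − μ_i h_i) r_i)` along fixed vectors `r_i`. -/
def linearDecomposition {n : ℕ} (μ : Fin n → ℝ) (r : Fin n → (Fin n → ℝ)) :
    ((Fin n → ℝ) × (Fin n → ℝ)) →ₗ[ℝ] ((Fin n → ℝ) × (Fin n → ℝ)) where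
  toFun x := (∑ i, x.1 i • r i, ∑ i, (x.2 i - μ i * x.1 i) • r i)
  map_add' x y := by
    ext1 <;> simp only [Prod.fst_add, Prod.snd_add, Pi.add_apply, ← Finset.sum_add_distrib] <;>
      refine Finset.sum_congr rfl fun i _ => ?_ <;> module
  map_smul' a x := by
    ext1 <;> simp only [Prod.smul_fst, Prod.smul_snd, Pi.smul_apply, Finset.smul_sum,
      smul_eq_mul, RingHom.id_apply] <;>
      refine Finset.sum_congr rfl fun i _ => ?_ <;> module

theorem linearDecomposition_injective {n : ℕ} (μ : Fin n → ℝ) {r : Fin n → (Fin n → ℝ)}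
    (hr : LinearIndependent ℝ r) : Function.Injective (linearDecomposition μ r) := by
  rw [← LinearMap.ker_eq_bot, LinearMap.ker_eq_bot']
  intro x hx
  rw [Fintype.linearIndependent_iff] at hr
  have h1 := hr x.1 (congrArg Prod.fst hx)
  have h2 := hr (fun i => x.2 i - μ i * x.1 i) (congrArg Prod.snd hx)
  ext i
  · exact h1 i
  · have := h2 i
    simp only [h1 i, mul_zero, sub_zero] at this
    exact this

theorem approximatesLinearOn_LamHat {n : ℕ} {μ : Fin n → ℝ} {θ : ℝ → ℝ}
    {rt : Fin n → (Fin n → ℝ) → ℝ → ℝ → (Fin n → ℝ)} {r : Fin n → (Fin n → ℝ)}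
    {ω v : Fin n → ℝ} {M η : ℝ} {c : ℝ≥0} (hη : 0 ≤ η) (hM : 0 < M)
    (hθ : ∀ s t, |θ s - θ t| ≤ |s - t|) (hθ0 : ∀ s, M ≤ |s| → θ s = 0) (hθz : θ 0 = 0)
    (hrt : ∀ i s t, ‖rt i ω (v i) s - rt i ω (v i) t‖ ≤ η * |s - t|)
    (hr : ∀ i, ‖rt i ω (v i) (μ i) - r i‖ ≤ η)
    (hc : η * ∑ i, ((3 * M + 1) * (1 + 3 * M + |μ i|) + (1 + |μ i|)) ≤ c)
    {L : ((Fin n → ℝ) × (Fin n → ℝ)) ≃L[ℝ] ((Fin n → ℝ) × (Fin n → ℝ))}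
    (hL : ∀ x, L x = linearDecomposition μ r x) :
    ApproximatesLinearOn (LamHat μ θ rt ω v)
      (L : ((Fin n → ℝ) × (Fin n → ℝ)) →L[ℝ] ((Fin n → ℝ) × (Fin n → ℝ))) univ c := by
  intro x _ y _
  have hterm := fun i => norm_decomposition_term_sub_le (R := fun s => rt i ω (v i) (μ i - θ s))
    (b := rt i ω (v i) (μ i)) (r₀ := r i) (lam := μ i) (D := ‖x - y‖) hη hM
    (fun s t => (hrt i _ _).trans (mul_le_mul_of_nonneg_left (by
      rw [sub_sub_sub_cancel_left, abs_sub_comm s t]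
      exact hθ t s) hη))
    (fun s hs => by simp only [hθ0 s hs, sub_zero]) (by simp only [hθz, sub_zero]) (hr i)
    (h := x.1 i) (g := x.2 i) (h' := y.1 i) (g' := y.2 i)
    ((norm_le_pi_norm (x.1 - y.1) i).trans (norm_fst_le (x - y)))
    ((norm_le_pi_norm (x.2 - y.2) i).trans (norm_snd_le (x - y)))
  refine le_trans ?_ (mul_le_mul_of_nonneg_right hc (norm_nonneg _))
  rw [Finset.mul_sum, Finset.sum_mul, ContinuousLinearEquiv.coe_coe, hL]
  refine max_le ?_ ?_
  · refine le_trans (le_of_eq ?_) (norm_sum_le_of_le _ fun i _ => (hterm i).1)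
    simp only [LamHat, linearDecomposition, LinearMap.coe_mk, AddHom.coe_mk, Prod.fst_sub,
      Finset.sum_sub_distrib, Pi.sub_apply]
  · refine le_trans (le_of_eq ?_) (norm_sum_le_of_le _ fun i _ => (hterm i).2)
    simp only [LamHat, linearDecomposition, LinearMap.coe_mk, AddHom.coe_mk, Prod.fst_sub,
      Prod.snd_sub, Finset.sum_sub_distrib, Pi.sub_apply]

theorem contDiffAt_cutoff_div {k : WithTop ℕ∞} {θ : ℝ → ℝ} {M : ℝ} (hθs : ContDiff ℝ k θ)
    (hθ0 : ∀ s, M ≤ |s| → θ s = 0) (hθz : θ 0 = 0) {p : ℝ × ℝ} (hp : ¬(p.1 = 0 ∧ p.2 = 0)) :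
    ContDiffAt ℝ k (fun q : ℝ × ℝ => θ (q.2 / q.1)) p := by
  by_cases h1 : p.1 = 0
  · have h2 : p.2 ≠ 0 := fun h => hp ⟨h1, h⟩
    have hlt : M * |p.1| < |p.2| := by rw [h1, abs_zero, mul_zero]; exact abs_pos.2 h2
    have hev : ∀ᶠ q : ℝ × ℝ in 𝓝 p, M * |q.1| < |q.2| :=
      ContinuousAt.eventually_lt (by fun_prop) (by fun_prop) hlt
    refine (contDiffAt_const (c := (0 : ℝ))).congr_of_eventuallyEq ?_
    filter_upwards [hev] with q hq
    by_cases hq1 : q.1 = 0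
    · rw [hq1, div_zero, hθz]
    · apply hθ0
      rw [abs_div, le_div_iff₀ (abs_pos.2 hq1)]
      exact hq.le
  · exact hθs.contDiffAt.comp p (contDiffAt_snd.div contDiffAt_fst h1)

theorem contDiffAt_LamHat {n : ℕ} {k : WithTop ℕ∞} {μ : Fin n → ℝ} {θ : ℝ → ℝ}
    {rt : Fin n → (Fin n → ℝ) → ℝ → ℝ → (Fin n → ℝ)} {ω v : Fin n → ℝ} {M : ℝ}
    (hθs : ContDiff ℝ k θ) (hθ0 : ∀ s, M ≤ |s| → θ s = 0) (hθz : θ 0 = 0)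
    (hrt : ∀ i, ContDiff ℝ k (fun σ => rt i ω (v i) σ)) {x : (Fin n → ℝ) × (Fin n → ℝ)}
    (hx : ∀ i, ¬(x.1 i = 0 ∧ x.2 i = 0)) : ContDiffAt ℝ k (LamHat μ θ rt ω v) x := by
  have hfst : ∀ i, ContDiff ℝ k (fun y : (Fin n → ℝ) × (Fin n → ℝ) => y.1 i) :=
    fun i => by fun_prop
  have hsnd : ∀ i, ContDiff ℝ k (fun y : (Fin n → ℝ) × (Fin n → ℝ) => y.2 i) :=
    fun i => by fun_prop
  have hR : ∀ i, ContDiffAt ℝ k (fun y : (Fin n → ℝ) × (Fin n → ℝ) =>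
      rt i ω (v i) (μ i - θ (y.2 i / y.1 i))) x := fun i => by
    have hq : ContDiffAt ℝ k
        (fun y : (Fin n → ℝ) × (Fin n → ℝ) => θ (y.2 i / y.1 i)) x :=
      ContDiffAt.comp (g := fun q : ℝ × ℝ => θ (q.2 / q.1)) x
        (contDiffAt_cutoff_div (p := (x.1 i, x.2 i)) hθs hθ0 hθz (hx i))
        ((hfst i).prodMk (hsnd i)).contDiffAt
    exact (hrt i).contDiffAt.comp x (contDiffAt_const.sub hq)
  refine ContDiffAt.prodMk (ContDiffAt.sum fun i _ => ?_) (ContDiffAt.sum fun i _ => ?_)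
  · exact (hfst i).contDiffAt.smul (hR i)
  · exact ((hsnd i).sub (contDiff_const.mul (hfst i))).contDiffAt.smul (hR i)

/-- Lemma 11.2 of Bianchini–Bressan.  For `|u − u*|` and `|v|` small, the
system `z = Σ h_i r̃_i`, `Υ = Σ (g_i − λ_i* h_i) r̃_i` has a unique solution `(h,g)` for every
`(z,Υ)`; the map `(z,Υ) ↦ (h,g)` is Lipschitz continuous on all of `ℝ²ⁿ` and smooth outside
the manifolds `N̂_i = {h_i = g_i = 0}`. -/
theorem perturbation_decomposition_wellposed
    {n : ℕ} (A : (Fin n → ℝ) → ((Fin n → ℝ) →L[ℝ] (Fin n → ℝ))) (hA : ContDiff ℝ (⊤ : ℕ∞) A)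
    (lam : (Fin n → ℝ) → Fin n → ℝ) (r : Fin n → (Fin n → ℝ) → (Fin n → ℝ))
    (hlam : ∀ ω, StrictMono (lam ω))
    (hr : ∀ ω i, ‖r i ω‖ = 1 ∧ A ω (r i ω) = lam ω i • r i ω)
    (ustar : Fin n → ℝ)
    (δ₁ : ℝ) (hδ₁ : 0 < δ₁)
    (θ : ℝ → ℝ) (hθs : ContDiff ℝ (⊤ : ℕ∞) θ) (hθodd : ∀ s, θ (-s) = -θ s)
    (hθb : ∀ s, |θ s| ≤ 2 * δ₁)
    (hθid : ∀ s, |s| ≤ δ₁ → θ s = s) (hθ0 : ∀ s, 3 * δ₁ ≤ |s| → θ s = 0)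
    (hθ' : ∀ s, |deriv θ s| ≤ 1) (hθ'' : ∀ s, |deriv (deriv θ) s| ≤ 4 / δ₁)
    (rt : Fin n → (Fin n → ℝ) → ℝ → ℝ → (Fin n → ℝ))
    (hrt_smooth : ∀ i, ContDiff ℝ (⊤ : ℕ∞) (fun p : (Fin n → ℝ) × ℝ × ℝ => rt i p.1 p.2.1 p.2.2))
    (hrt_unit : ∀ i ω v σ, ‖rt i ω v σ‖ = 1)
    (hrt_zero : ∀ i ω σ, rt i ω 0 σ = r i ω)
    (Cr : ℝ) (hCr : 0 < Cr)
    (hrt_σ : ∀ i ω v σ, ‖deriv (fun s => rt i ω v s) σ‖ ≤ Cr * |v|)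
    (hrt_σσ : ∀ i ω v σ, ‖deriv (fun s => deriv (fun s' => rt i ω v s') s) σ‖ ≤ Cr * |v|)
    (hrt_uσ : ∀ i ω v σ,
      ‖fderiv ℝ (fun ω' => deriv (fun s => rt i ω' v s) σ) ω‖ ≤ Cr * |v|) :
    ∃ ε > (0:ℝ), ∀ (ω : Fin n → ℝ) (v : Fin n → ℝ), ‖ω - ustar‖ < ε → ‖v‖ < ε →
      ∃ Φ : (Fin n → ℝ) × (Fin n → ℝ) → (Fin n → ℝ) × (Fin n → ℝ),
        -- existence and uniqueness of the decomposition, for every `(z,Υ)`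
        (∀ zU : (Fin n → ℝ) × (Fin n → ℝ),
          LamHat (lam ustar) θ rt ω v (Φ zU) = zU ∧
          (∀ hg : (Fin n → ℝ) × (Fin n → ℝ),
            LamHat (lam ustar) θ rt ω v hg = zU → hg = Φ zU)) ∧
        -- Lipschitz continuity on the whole space
        (∃ Lip : ℝ≥0, LipschitzWith Lip Φ) ∧
        -- smoothness outside the manifolds `N̂_i = {h_i = g_i = 0}`
        ContDiffOn ℝ (⊤ : ℕ∞) Φ
          {zU : (Fin n → ℝ) × (Fin n → ℝ) | ∀ i, ¬((Φ zU).1 i = 0 ∧ (Φ zU).2 i = 0)} := by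
  have hθz : θ 0 = 0 := hθid 0 (by rw [abs_zero]; exact hδ₁.le)
  have hθlip : ∀ s t, |θ s - θ t| ≤ |s - t| := fun s t => by
    simpa using Convex.norm_image_sub_le_of_norm_deriv_le (f := θ) (C := 1)
      (fun x _ => hθs.differentiable (by simp) x) (fun x _ => hθ' x) convex_univ
      (mem_univ t) (mem_univ s)
  have hσ : ∀ i ω v, ContDiff ℝ (⊤ : ℕ∞) (fun σ => rt i ω v σ) := fun i ω v =>
    (hrt_smooth i).comp (contDiff_const.prodMk (contDiff_const.prodMk contDiff_id))
  set μ := lam ustar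
  let L : ((Fin n → ℝ) × (Fin n → ℝ)) ≃L[ℝ] ((Fin n → ℝ) × (Fin n → ℝ)) :=
    (LinearEquiv.ofInjectiveEndo (linearDecomposition μ fun i => r i ustar)
      (linearDecomposition_injective μ (linearIndependent_of_strictMono_eigenvalues (hlam ustar)
        (hr ustar)))).toContinuousLinearEquiv
  have hL : ∀ x, L x = linearDecomposition μ (fun i => r i ustar) x := fun x => rfl
  obtain ⟨c, hc0, hc⟩ : ∃ c : ℝ≥0, 0 < c ∧ (Subsingleton ((Fin n → ℝ) × (Fin n → ℝ)) ∨
      c < ‖(L.symm : ((Fin n → ℝ) × (Fin n → ℝ)) →L[ℝ] ((Fin n → ℝ) × (Fin n → ℝ)))‖₊⁻¹) := by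
    rcases L.subsingleton_or_nnnorm_symm_pos with h | h
    · exact ⟨1, one_pos, Or.inl h⟩
    · obtain ⟨c, h0, h1⟩ := exists_between (inv_pos.2 h)
      exact ⟨c, h0, Or.inr h1⟩
  have hS : 0 ≤ ∑ i, ((3 * (3 * δ₁) + 1) * (1 + 3 * (3 * δ₁) + |μ i|) + (1 + |μ i|)) :=
    Finset.sum_nonneg fun i _ => by positivity
  set S := ∑ i, ((3 * (3 * δ₁) + 1) * (1 + 3 * (3 * δ₁) + |μ i|) + (1 + |μ i|))
  obtain ⟨η, hη, hηc⟩ : ∃ η : ℝ, 0 < η ∧ η * S ≤ c := by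
    have hc0' : (0 : ℝ) < c := hc0
    refine ⟨c / (1 + S), by positivity, ?_⟩
    rw [div_mul_eq_mul_div, div_le_iff₀ (by positivity)]
    exact mul_le_mul_of_nonneg_left (by linarith) hc0'.le
  have hcont : ∀ i, ∀ᶠ p : (Fin n → ℝ) × (Fin n → ℝ) in 𝓝 (ustar, 0),
      ‖rt i p.1 (p.2 i) (μ i) - r i ustar‖ < η := fun i => by
    have hcts : Continuous fun p : (Fin n → ℝ) × (Fin n → ℝ) =>
        ‖rt i p.1 (p.2 i) (μ i) - r i ustar‖ :=
      (((hrt_smooth i).continuous.comp (f := fun p : (Fin n → ℝ) × (Fin n → ℝ) =>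
        (p.1, p.2 i, μ i)) (by fun_prop)).sub continuous_const).norm
    refine hcts.continuousAt.eventually_lt_const ?_
    simpa [hrt_zero] using hη
  obtain ⟨ε₀, hε₀, hball⟩ := Metric.eventually_nhds_iff.1 (eventually_all.2 hcont)
  refine ⟨min ε₀ (η / Cr), lt_min hε₀ (div_pos hη hCr), fun ω v hω hv => ?_⟩
  have hr' : ∀ i, ‖rt i ω (v i) (μ i) - r i ustar‖ ≤ η := fun i => by
    refine (hball (y := (ω, v)) ?_ i).le
    rw [Prod.dist_eq]
    refine max_lt ?_ ?_
    · rw [dist_eq_norm]; exact hω.trans_le (min_le_left _ _)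
    · rw [dist_zero_right]; exact hv.trans_le (min_le_left _ _)
  have hrt' : ∀ i s t, ‖rt i ω (v i) s - rt i ω (v i) t‖ ≤ η * |s - t| := fun i s t => by
    refine Convex.norm_image_sub_le_of_norm_deriv_le (f := fun σ => rt i ω (v i) σ)
      (fun x _ => (hσ i ω (v i)).differentiable (by simp) x) (fun x _ => ?_) convex_univ
      (mem_univ t) (mem_univ s)
    refine (hrt_σ i ω (v i) x).trans ?_
    have h1 : |v i| ≤ η / Cr :=
      (norm_le_pi_norm v i).trans (hv.le.trans (min_le_right _ _))
    rw [le_div_iff₀ hCr] at h1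
    linarith
  have happ := approximatesLinearOn_LamHat hη.le (by positivity : 0 < 3 * δ₁) hθlip hθ0 hθz hrt'
    hr' hηc hL
  let e := happ.toHomeomorph _ hc
  have he : ∀ x, e x = LamHat μ θ rt ω v x := fun x => rfl
  have hanti : AntilipschitzWith _ e := fun x y =>
    happ.antilipschitz hc ⟨x, mem_univ x⟩ ⟨y, mem_univ y⟩
  refine ⟨e.symm, fun zU => ⟨e.apply_symm_apply zU, fun hg h => ?_⟩,
    ⟨_, hanti.to_rightInverse e.apply_symm_apply⟩, fun zU hzU => ?_⟩
  · rw [← h, ← he, e.symm_apply_apply]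
  · exact (happ.contDiffAt_toHomeomorph_symm (by simp) hc (contDiffAt_LamHat hθs hθ0 hθz
      (fun i => hσ i ω (v i)) hzU)).contDiffWithinAt
end
end

section
/- There exists a constant C, depending only on ‖A‖_{L∞}, with the following property. Let u = u(t,x) be smooth with s ↦ ‖u_x(s)‖_{L∞} locally integrable, and let z be a bounded smooth solution of the linearized equation z_t + (A(u)z)_x + [DA(u)·z]u_x − [DA(u)·u_x]z = z_xx whose initial data satisfy |z(0,x)| ≤ 1 for x ≤ 0 and z(0,x) = 0 for x > 0. Then for all t ≥ 0 and x ∈ ℝ, |z(t,x)| ≤ 2 · exp{ Ct + 4 ‖DA‖_{L∞} ∫₀^t ‖u_x(s)‖_{L∞} ds + t − x }. -/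
open MeasureTheory Filter Topology Set
open scoped ENNReal

noncomputable section

/-- Partial derivative in time of a function of `(t, x)`. -/
def pdt {n : ℕ} (u : ℝ → ℝ → (Fin n → ℝ)) (t x : ℝ) : Fin n → ℝ :=
  deriv (fun s => u s x) t

/-- Partial derivative in space. -/
def pdx {n : ℕ} (u : ℝ → ℝ → (Fin n → ℝ)) (t x : ℝ) : Fin n → ℝ :=
  deriv (fun y => u t y) x

/-- Second partial derivative in space. -/
def pdx2 {n : ℕ} (u : ℝ → ℝ → (Fin n → ℝ)) (t x : ℝ) : Fin n → ℝ :=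
  pdx (fun s y => pdx u s y) t x

/-- The one-dimensional heat kernel at time `τ`. -/
def heatKernel (τ w : ℝ) : ℝ :=
  (√(4 * Real.pi * τ))⁻¹ * Real.exp (-w ^ 2 / (4 * τ))

lemma heatKernel_nonneg (τ w : ℝ) : 0 ≤ heatKernel τ w := by
  unfold heatKernel; positivity

lemma heatKernel_eq_gaussianPDFReal {τ : ℝ} (hτ : 0 < τ) (w : ℝ) :
    heatKernel τ w =
      ProbabilityTheory.gaussianPDFReal 0 (2 * τ).toNNReal w := by
  simp only [heatKernel, ProbabilityTheory.gaussianPDFReal, sub_zero,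
    Real.coe_toNNReal (2 * τ) (by positivity)]
  ring_nf

lemma integrable_heatKernel {τ : ℝ} (hτ : 0 < τ) : Integrable (heatKernel τ) := by
  rw [funext (heatKernel_eq_gaussianPDFReal hτ)]
  exact ProbabilityTheory.integrable_gaussianPDFReal _ _

lemma integral_heatKernel {τ : ℝ} (hτ : 0 < τ) : ∫ w, heatKernel τ w = 1 := by
  rw [funext (heatKernel_eq_gaussianPDFReal hτ)]
  exact ProbabilityTheory.integral_gaussianPDFReal_eq_one _ (by simpa using hτ)

lemma heatKernel_mul_exp {τ : ℝ} (hτ : 0 < τ) (x y : ℝ) :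
    heatKernel τ (x - y) * Real.exp (-y)
      = Real.exp τ * Real.exp (-x) * heatKernel τ ((x - 2 * τ) - y) := by
  have h : Real.exp (-(x - y) ^ 2 / (4 * τ)) * Real.exp (-y)
      = Real.exp τ * Real.exp (-x) * Real.exp (-((x - 2 * τ) - y) ^ 2 / (4 * τ)) := by
    rw [← Real.exp_add, ← Real.exp_add, ← Real.exp_add]
    congr 1
    field_simp
    ring
  unfold heatKernel
  rw [mul_assoc, h]
  ring

/-- The exponential weight `e^{-y} + η`, bounded below by `η`. -/
def expWeight (η y : ℝ) : ℝ := Real.exp (-y) + η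

lemma heatKernel_mul_expWeight {τ : ℝ} (hτ : 0 < τ) (η x y : ℝ) :
    heatKernel τ (x - y) * expWeight η y
      = Real.exp τ * Real.exp (-x) * heatKernel τ ((x - 2 * τ) - y)
        + η * heatKernel τ (x - y) := by
  rw [expWeight, mul_add, heatKernel_mul_exp hτ]
  ring

lemma integrable_heatKernel_mul_expWeight {τ : ℝ} (hτ : 0 < τ) (η x : ℝ) :
    Integrable fun y => heatKernel τ (x - y) * expWeight η y := by
  simp_rw [heatKernel_mul_expWeight hτ]
  exact (((integrable_heatKernel hτ).comp_sub_left _).const_mul _).add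
    (((integrable_heatKernel hτ).comp_sub_left _).const_mul _)

lemma integral_heatKernel_mul_expWeight_le {τ η : ℝ} (hτ : 0 < τ) (hη : 0 ≤ η) (x : ℝ) :
    ∫ y, heatKernel τ (x - y) * expWeight η y ≤ Real.exp τ * expWeight η x := by
  simp_rw [heatKernel_mul_expWeight hτ]
  rw [integral_add (((integrable_heatKernel hτ).comp_sub_left _).const_mul _)
    (((integrable_heatKernel hτ).comp_sub_left _).const_mul _),
    integral_const_mul, integral_const_mul,
    integral_sub_left_eq_self (heatKernel τ) volume, integral_sub_left_eq_self (heatKernel τ) volume,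
    integral_heatKernel hτ, expWeight]
  nlinarith [Real.one_le_exp hτ.le]

lemma expWeight_nonneg {η : ℝ} (hη : 0 ≤ η) (y : ℝ) : 0 ≤ expWeight η y := by
  unfold expWeight; positivity

lemma intervalIntegral_heatKernel_mul_expWeight_le {τ η : ℝ} (hτ : 0 < τ) (hη : 0 ≤ η)
    (x : ℝ) {a : ℝ} (ha : 0 ≤ a) :
    ∫ y in (-a)..a, heatKernel τ (x - y) * expWeight η y ≤ Real.exp τ * expWeight η x := by
  rw [intervalIntegral.integral_of_le (by linarith)]
  exact (setIntegral_le_integral (integrable_heatKernel_mul_expWeight hτ η x)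
    (ae_of_all _ fun y => mul_nonneg (heatKernel_nonneg _ _) (expWeight_nonneg hη y))).trans
    (integral_heatKernel_mul_expWeight_le hτ hη x)

/-- The space derivative of the heat kernel. -/
def heatKernelDx (τ w : ℝ) : ℝ := -(w / (2 * τ)) * heatKernel τ w

/-- The second space derivative of the heat kernel, which is also its time derivative. -/
def heatKernelDxx (τ w : ℝ) : ℝ := (w ^ 2 / (4 * τ ^ 2) - 1 / (2 * τ)) * heatKernel τ w

lemma hasDerivAt_heatKernel {τ : ℝ} (hτ : 0 < τ) (w : ℝ) :
    HasDerivAt (heatKernel τ) (heatKernelDx τ w) w := by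
  have h : HasDerivAt (fun w : ℝ => -w ^ 2 / (4 * τ)) (-(2 * w) / (4 * τ)) w := by
    simpa using ((hasDerivAt_pow 2 w).neg.div_const (4 * τ))
  refine (h.exp.const_mul (√(4 * Real.pi * τ))⁻¹).congr_deriv ?_
  unfold heatKernelDx heatKernel
  field_simp
  ring

lemma hasDerivAt_heatKernelDx {τ : ℝ} (hτ : 0 < τ) (w : ℝ) :
    HasDerivAt (heatKernelDx τ) (heatKernelDxx τ w) w := by
  have h : HasDerivAt (fun w : ℝ => -(w / (2 * τ))) (-(1 / (2 * τ))) w :=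
    ((hasDerivAt_id w).div_const (2 * τ)).neg
  refine (h.mul (hasDerivAt_heatKernel hτ w)).congr_deriv ?_
  unfold heatKernelDxx heatKernelDx
  field_simp
  ring

lemma hasDerivAt_heatKernel_time {τ : ℝ} (hτ : 0 < τ) (w : ℝ) :
    HasDerivAt (fun τ => heatKernel τ w) (heatKernelDxx τ w) τ := by
  have hpos : 0 < 4 * Real.pi * τ := by positivity
  have h1 : HasDerivAt (fun τ : ℝ => 4 * Real.pi * τ) (4 * Real.pi) τ := by
    simpa using (hasDerivAt_id τ).const_mul (4 * Real.pi)
  have h2 := (h1.sqrt hpos.ne').inv (Real.sqrt_pos.2 hpos).ne'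
  have h3 : HasDerivAt (fun τ : ℝ => -w ^ 2 / (4 * τ)) (w ^ 2 / (4 * τ ^ 2)) τ := by
    have h4 : HasDerivAt (fun τ : ℝ => 4 * τ) 4 τ := by
      simpa using (hasDerivAt_id τ).const_mul 4
    refine ((hasDerivAt_const τ (-w ^ 2)).div h4 (by positivity)).congr_deriv ?_
    field_simp
    ring
  refine (h2.mul h3.exp).congr_deriv ?_
  unfold heatKernelDxx heatKernel
  simp only [Pi.inv_apply]
  rw [Real.sq_sqrt hpos.le]
  have hs := (Real.sqrt_pos.2 hpos).ne'
  field_simp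
  ring

lemma abs_heatKernelDx_le {τ : ℝ} (hτ : 0 < τ) (w : ℝ) :
    |heatKernelDx τ w| ≤ (√τ)⁻¹ * heatKernel (2 * τ) w := by
  have hs : 0 < √τ := Real.sqrt_pos.2 hτ
  have hsq : √τ ^ 2 = τ := Real.sq_sqrt hτ.le
  have h2 : √(4 * Real.pi * (2 * τ)) = √2 * √(4 * Real.pi * τ) := by
    rw [← Real.sqrt_mul (by norm_num)]
    ring_nf
  have hp : 0 < √(4 * Real.pi * τ) := Real.sqrt_pos.2 (by positivity)
  have hsplit : Real.exp (-w ^ 2 / (4 * τ))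
      = Real.exp (-w ^ 2 / (4 * (2 * τ))) * Real.exp (-(w ^ 2 / (8 * τ))) := by
    rw [← Real.exp_add]
    congr 1
    field_simp
    ring
  have hexp : Real.exp (-(w ^ 2 / (8 * τ))) ≤ (1 + w ^ 2 / (8 * τ))⁻¹ := by
    rw [Real.exp_neg]
    exact inv_anti₀ (by positivity) (by linarith [Real.add_one_le_exp (w ^ 2 / (8 * τ))])
  have hkey : |w| / (2 * τ) * Real.exp (-(w ^ 2 / (8 * τ))) ≤ (√τ)⁻¹ * (√2)⁻¹ := by
    refine (mul_le_mul_of_nonneg_left hexp (by positivity)).trans ?_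
    rw [← div_eq_mul_inv, div_le_iff₀ (by positivity), ← mul_inv, ← div_eq_inv_mul,
      le_div_iff₀ (by positivity)]
    have e2 : √2 ^ 2 = 2 := Real.sq_sqrt (by norm_num)
    set r := |w| / √τ with hr
    have hw : |w| = r * √τ := by rw [hr]; field_simp
    have hw2 : w ^ 2 = r ^ 2 * τ := by
      rw [← sq_abs, hw, mul_pow, hsq]
    rw [hw2, hw]
    have : r * √τ / (2 * τ) * (√τ * √2) = r * √2 / 2 := by
      have : √τ * √τ = τ := Real.mul_self_sqrt hτ.le
      calc _ = r * √2 * (√τ * √τ) / (2 * τ) := by ring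
        _ = _ := by rw [this]; field_simp
    rw [this]
    have : r ^ 2 * τ / (8 * τ) = r ^ 2 / 8 := by field_simp
    rw [this]
    nlinarith [sq_nonneg (r / √8 - 1), sq_nonneg (r - 2 * √2)]
  unfold heatKernelDx heatKernel
  rw [abs_mul, abs_neg, abs_div, abs_of_pos (show 0 < 2 * τ by positivity),
    abs_of_nonneg (a := (√(4 * Real.pi * τ))⁻¹ * Real.exp (-w ^ 2 / (4 * τ))) (by positivity),
    hsplit, h2, mul_inv]
  calc _ = (|w| / (2 * τ) * Real.exp (-(w ^ 2 / (8 * τ)))) *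
        ((√(4 * Real.pi * τ))⁻¹ * Real.exp (-w ^ 2 / (4 * (2 * τ)))) := by ring
    _ ≤ ((√τ)⁻¹ * (√2)⁻¹) *
        ((√(4 * Real.pi * τ))⁻¹ * Real.exp (-w ^ 2 / (4 * (2 * τ)))) :=
      mul_le_mul_of_nonneg_right hkey (by positivity)
    _ = _ := by ring

lemma continuousOn_heatKernel :
    ContinuousOn (fun p : ℝ × ℝ => heatKernel p.1 p.2) (Ioi 0 ×ˢ univ) := by
  unfold heatKernel
  refine ContinuousOn.mul (ContinuousOn.inv₀ (by fun_prop) fun p hp => ?_)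
    (Real.continuous_exp.comp_continuousOn
      (ContinuousOn.div (by fun_prop) (by fun_prop) fun p hp => ?_))
  · have : 0 < p.1 := hp.1
    positivity
  · have : 0 < p.1 := hp.1
    positivity

lemma continuousOn_heatKernelDxx :
    ContinuousOn (fun p : ℝ × ℝ => heatKernelDxx p.1 p.2) (Ioi 0 ×ˢ univ) := by
  unfold heatKernelDxx
  refine ContinuousOn.mul (ContinuousOn.sub
    (ContinuousOn.div (by fun_prop) (by fun_prop) fun p hp => ?_)
    (ContinuousOn.div (by fun_prop) (by fun_prop) fun p hp => ?_)) continuousOn_heatKernel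
  all_goals
    have : 0 < p.1 := hp.1
    positivity

lemma continuous_heatKernel (τ : ℝ) : Continuous (heatKernel τ) := by
  unfold heatKernel; fun_prop

lemma continuous_heatKernelDx (τ : ℝ) : Continuous (heatKernelDx τ) := by
  unfold heatKernelDx heatKernel; fun_prop

lemma continuous_heatKernelDxx (τ : ℝ) : Continuous (heatKernelDxx τ) := by
  unfold heatKernelDxx heatKernel; fun_prop

lemma continuous_expWeight (η : ℝ) : Continuous (expWeight η) := by
  unfold expWeight; fun_prop

lemma intervalIntegral_abs_heatKernelDx_mul_expWeight_le {τ η : ℝ} (hτ : 0 < τ) (hη : 0 ≤ η)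
    (x : ℝ) {a : ℝ} (ha : 0 ≤ a) :
    ∫ y in (-a)..a, |heatKernelDx τ (x - y)| * expWeight η y
      ≤ (√τ)⁻¹ * (Real.exp (2 * τ) * expWeight η x) := by
  calc _ ≤ ∫ y in (-a)..a, (√τ)⁻¹ * (heatKernel (2 * τ) (x - y) * expWeight η y) := by
        have c1 := continuous_heatKernelDx τ
        have c2 := continuous_heatKernel (2 * τ)
        have c3 := continuous_expWeight η
        refine intervalIntegral.integral_mono_on (by linarith)
          (Continuous.intervalIntegrable (by fun_prop) _ _)
          (Continuous.intervalIntegrable (by fun_prop) _ _) fun y _ => ?_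
        rw [← mul_assoc]
        exact mul_le_mul_of_nonneg_right (abs_heatKernelDx_le hτ _) (expWeight_nonneg hη y)
    _ ≤ _ := by
      rw [intervalIntegral.integral_const_mul]
      exact mul_le_mul_of_nonneg_left
        (intervalIntegral_heatKernel_mul_expWeight_le (by positivity) hη x ha) (by positivity)

lemma AbsolutelyContinuousOnInterval.exp_comp {f : ℝ → ℝ} {a b : ℝ}
    (hf : AbsolutelyContinuousOnInterval f a b) :
    AbsolutelyContinuousOnInterval (fun s => Real.exp (f s)) a b := by
  obtain ⟨M, hM⟩ := hf.exists_bound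
  have hlip : ∀ p ∈ Iic M, ∀ q ∈ Iic M,
      dist (Real.exp p) (Real.exp q) ≤ Real.exp M * dist p q := by
    intro p hp q hq
    have := (convex_Iic M).norm_image_sub_le_of_norm_deriv_le (f := Real.exp) (C := Real.exp M)
      (fun x _ => Real.differentiableAt_exp)
      (fun x hx => by simpa [abs_of_pos (Real.exp_pos x)] using hx) hq hp
    simpa [dist_eq_norm] using this
  rw [absolutelyContinuousOnInterval_iff] at hf ⊢
  intro ε hε
  obtain ⟨δ, hδ, h⟩ := hf (ε / Real.exp M) (by positivity)
  refine ⟨δ, hδ, fun E hE hlt => ?_⟩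
  have hsum := h E hE hlt
  rw [lt_div_iff₀ (Real.exp_pos M), mul_comm, Finset.mul_sum] at hsum
  refine lt_of_le_of_lt (Finset.sum_le_sum fun i hi => ?_) hsum
  have hmem := hE.1 i hi
  exact hlip _ ((le_abs_self _).trans (hM _ hmem.1)) _ ((le_abs_self _).trans (hM _ hmem.2))

/-- `∫₀ᵗ V exp(∫₀ˢ V) ds = exp(∫₀ᵗ V) - 1` for merely integrable `V`. -/
lemma integral_mul_exp_primitive {V : ℝ → ℝ} {t : ℝ} (hV : IntervalIntegrable V volume 0 t) :
    ∫ s in (0 : ℝ)..t, V s * Real.exp (∫ r in (0 : ℝ)..s, V r)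
      = Real.exp (∫ r in (0 : ℝ)..t, V r) - 1 := by
  have hac := (hV.absolutelyContinuousOnInterval_intervalIntegral (c := 0) (by simp)).exp_comp
  have h := hac.integral_deriv_eq_sub
  simp only [intervalIntegral.integral_same, Real.exp_zero] at h
  rw [← h]
  refine intervalIntegral.integral_congr_ae ?_
  filter_upwards [hV.ae_hasDerivAt_integral] with s hs hmem
  rw [((hs (uIoc_subset_uIcc hmem) 0 (by simp)).exp).deriv, mul_comm]

lemma hasDerivAt_intervalIntegral_of_continuousOn {F F' : ℝ → ℝ → ℝ} {S : Set ℝ}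
    (hS : IsOpen S) {a b s : ℝ} (hs : s ∈ S)
    (hF : ∀ r ∈ S, Continuous (F r))
    (hF' : ContinuousOn (fun p : ℝ × ℝ => F' p.1 p.2) (S ×ˢ univ))
    (hd : ∀ r ∈ S, ∀ y, HasDerivAt (fun q => F q y) (F' r y) r) :
    HasDerivAt (fun r => ∫ y in a..b, F r y) (∫ y in a..b, F' s y) s := by
  obtain ⟨δ, hδ, hball⟩ := Metric.nhds_basis_closedBall.mem_iff.1 (hS.mem_nhds hs)
  have hcomp : IsCompact (Metric.closedBall s δ ×ˢ uIcc a b) :=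
    (isCompact_closedBall s δ).prod isCompact_uIcc
  obtain ⟨M, hM⟩ := hcomp.exists_bound_of_continuousOn
    (hF'.mono (prod_mono hball (subset_univ _)))
  have hF's : Continuous (F' s) := by
    have : Continuous ((fun p : ℝ × ℝ => F' p.1 p.2) ∘ fun y => (s, y)) :=
      hF'.comp_continuous (by fun_prop) fun y => ⟨hs, mem_univ _⟩
    exact this
  refine (intervalIntegral.hasDerivAt_integral_of_dominated_loc_of_deriv_le
    (bound := fun _ => M) (Metric.closedBall_mem_nhds s hδ) ?_
    ((hF s hs).intervalIntegrable _ _) hF's.aestronglyMeasurable ?_ (by simp) ?_).2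
  · filter_upwards [hS.mem_nhds hs] with r hr using (hF r hr).aestronglyMeasurable
  · exact ae_of_all _ fun y hy r hr => hM (r, y) ⟨hr, uIoc_subset_uIcc hy⟩
  · exact ae_of_all _ fun y _ r hr => hd r (hball hr) y

lemma continuousOn_intervalIntegral_of_continuousOn {F : ℝ → ℝ → ℝ} {t a b : ℝ} (ht : 0 ≤ t)
    (hF : ContinuousOn (fun p : ℝ × ℝ => F p.1 p.2) (Icc 0 t ×ˢ univ)) :
    ContinuousOn (fun r => ∫ y in a..b, F r y) (Icc 0 t) := by
  have hc : Continuous (fun p : ℝ × ℝ => F (projIcc 0 t ht p.1) p.2) := by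
    have : Continuous ((fun p : ℝ × ℝ => F p.1 p.2) ∘
        fun p : ℝ × ℝ => ((projIcc 0 t ht p.1 : ℝ), p.2)) :=
      hF.comp_continuous (by fun_prop) fun p => ⟨(projIcc 0 t ht p.1).2, mem_univ _⟩
    exact this
  have := intervalIntegral.continuous_parametric_intervalIntegral_of_continuous'
    (f := fun r y => F (projIcc 0 t ht r) y) (μ := volume) hc a b
  refine this.continuousOn.congr fun r hr => ?_
  simp only [projIcc_of_mem ht hr]

/-- A polynomial cutoff, vanishing to first order at `±a`. -/
def cutoff (a y : ℝ) : ℝ := (1 - (y / a) ^ 2) ^ 2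

/-- The derivative of `cutoff a`. -/
def cutoffDx (a y : ℝ) : ℝ := -(4 * y / a ^ 2) * (1 - (y / a) ^ 2)

/-- The second derivative of `cutoff a`. -/
def cutoffDxx (a y : ℝ) : ℝ := -(4 / a ^ 2) * (1 - 3 * (y / a) ^ 2)

lemma hasDerivAt_cutoff (a y : ℝ) : HasDerivAt (cutoff a) (cutoffDx a y) y := by
  have h : HasDerivAt (fun y : ℝ => 1 - (y / a) ^ 2) (-(2 * y / a ^ 2)) y := by
    refine ((((hasDerivAt_id y).div_const a).pow 2).const_sub 1).congr_deriv ?_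
    simp only [id, Nat.cast_ofNat]
    ring
  refine (h.pow 2).congr_deriv ?_
  simp only [cutoffDx, Nat.cast_ofNat]
  ring

lemma hasDerivAt_cutoffDx (a y : ℝ) : HasDerivAt (cutoffDx a) (cutoffDxx a y) y := by
  have h : HasDerivAt (fun y : ℝ => 1 - (y / a) ^ 2) (-(2 * y / a ^ 2)) y := by
    refine ((((hasDerivAt_id y).div_const a).pow 2).const_sub 1).congr_deriv ?_
    simp only [id, Nat.cast_ofNat]
    ring
  have h' : HasDerivAt (fun y : ℝ => -(4 * y / a ^ 2)) (-(4 / a ^ 2)) y := by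
    refine (((hasDerivAt_id y).const_mul 4).div_const (a ^ 2)).neg.congr_deriv ?_
    simp
  refine (h'.mul h).congr_deriv ?_
  simp only [cutoffDxx]
  ring

lemma continuous_cutoff (a : ℝ) : Continuous (cutoff a) := by
  unfold cutoff; fun_prop

lemma continuous_cutoffDx (a : ℝ) : Continuous (cutoffDx a) := by
  unfold cutoffDx; fun_prop

lemma continuous_cutoffDxx (a : ℝ) : Continuous (cutoffDxx a) := by
  unfold cutoffDxx; fun_prop

lemma cutoff_nonneg (a y : ℝ) : 0 ≤ cutoff a y := by
  unfold cutoff; positivity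

lemma sq_div_le_one {a y : ℝ} (ha : 0 < a) (hy : y ∈ Icc (-a) a) : (y / a) ^ 2 ≤ 1 := by
  rw [div_pow, div_le_one (by positivity)]
  exact sq_le_sq' hy.1 hy.2

lemma cutoff_le_one {a y : ℝ} (ha : 0 < a) (hy : y ∈ Icc (-a) a) : cutoff a y ≤ 1 := by
  have := sq_div_le_one ha hy
  exact pow_le_one₀ (by linarith) (by linarith [sq_nonneg (y / a)])

lemma abs_cutoffDx_le {a y : ℝ} (ha : 0 < a) (hy : y ∈ Icc (-a) a) :
    |cutoffDx a y| ≤ 4 / a := by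
  have h1 := sq_div_le_one ha hy
  have h2 : |y / a| ≤ 1 := abs_le_one_iff_mul_self_le_one.2 (by rwa [← sq])
  have h3 : cutoffDx a y = -(4 / a) * (y / a) * (1 - (y / a) ^ 2) := by
    unfold cutoffDx; field_simp
  rw [h3, abs_mul, abs_mul, abs_neg, abs_of_pos (show 0 < 4 / a by positivity)]
  have h4 : |1 - (y / a) ^ 2| ≤ 1 := abs_le.2 ⟨by linarith, by linarith [sq_nonneg (y / a)]⟩
  calc 4 / a * |y / a| * |1 - (y / a) ^ 2| ≤ 4 / a * 1 * 1 := by gcongr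
    _ = 4 / a := by ring

lemma abs_cutoffDxx_le {a y : ℝ} (ha : 0 < a) (hy : y ∈ Icc (-a) a) :
    |cutoffDxx a y| ≤ 8 / a ^ 2 := by
  have h1 := sq_div_le_one ha hy
  rw [cutoffDxx, abs_mul, abs_neg, abs_of_pos (show 0 < 4 / a ^ 2 by positivity)]
  have h4 : |1 - 3 * (y / a) ^ 2| ≤ 2 :=
    abs_le.2 ⟨by linarith, by linarith [sq_nonneg (y / a)]⟩
  calc 4 / a ^ 2 * |1 - 3 * (y / a) ^ 2| ≤ 4 / a ^ 2 * 2 := by gcongr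
    _ = 8 / a ^ 2 := by ring

lemma cutoff_right {a : ℝ} (ha : a ≠ 0) : cutoff a a = 0 := by simp [cutoff, ha]

lemma cutoff_left {a : ℝ} (ha : a ≠ 0) : cutoff a (-a) = 0 := by
  simp [cutoff, ha]

lemma cutoffDx_right {a : ℝ} (ha : a ≠ 0) : cutoffDx a a = 0 := by simp [cutoffDx, ha]

lemma cutoffDx_left {a : ℝ} (ha : a ≠ 0) : cutoffDx a (-a) = 0 := by
  simp [cutoffDx, neg_div, ha]

/-- `v` solves the scalar equation `v_t + f_x = v_xx + g` on `(0,∞) × ℝ`, with `vt`, `vx`, `vxx`,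
`fx` the respective partial derivatives. -/
structure IsHeatSolution (v f g vt vx vxx fx : ℝ → ℝ → ℝ) : Prop where
  continuousOn : ContinuousOn (fun p : ℝ × ℝ => v p.1 p.2) (Ici 0 ×ˢ univ)
  continuousOn_vt : ContinuousOn (fun p : ℝ × ℝ => vt p.1 p.2) (Ioi 0 ×ˢ univ)
  hasDerivAt_vt : ∀ s > 0, ∀ y, HasDerivAt (fun r => v r y) (vt s y) s
  hasDerivAt_vx : ∀ s > 0, ∀ y, HasDerivAt (v s) (vx s y) y
  hasDerivAt_vxx : ∀ s > 0, ∀ y, HasDerivAt (vx s) (vxx s y) y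
  continuous_vxx : ∀ s > 0, Continuous (vxx s)
  hasDerivAt_fx : ∀ s > 0, ∀ y, HasDerivAt (f s) (fx s y) y
  continuous_fx : ∀ s > 0, Continuous (fx s)
  eqn : ∀ s > 0, ∀ y, vt s y + fx s y = vxx s y + g s y

namespace IsHeatSolution

variable {v f g vt vx vxx fx : ℝ → ℝ → ℝ}

lemma continuous_slice (h : IsHeatSolution v f g vt vx vxx fx) {s : ℝ} (hs : 0 ≤ s) :
    Continuous (v s) := by
  have : Continuous ((fun p : ℝ × ℝ => v p.1 p.2) ∘ fun y => (s, y)) :=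
    h.continuousOn.comp_continuous (by fun_prop) fun y => ⟨hs, mem_univ _⟩
  exact this

lemma continuous_vt (h : IsHeatSolution v f g vt vx vxx fx) {s : ℝ} (hs : 0 < s) :
    Continuous (vt s) := by
  have : Continuous ((fun p : ℝ × ℝ => vt p.1 p.2) ∘ fun y => (s, y)) :=
    h.continuousOn_vt.comp_continuous (by fun_prop) fun y => ⟨hs, mem_univ _⟩
  exact this

lemma continuous_f (h : IsHeatSolution v f g vt vx vxx fx) {s : ℝ} (hs : 0 < s) :
    Continuous (f s) :=
  continuous_iff_continuousAt.2 fun y => (h.hasDerivAt_fx s hs y).continuousAt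

lemma continuous_g (h : IsHeatSolution v f g vt vx vxx fx) {s : ℝ} (hs : 0 < s) :
    Continuous (g s) := by
  have : g s = fun y => vt s y + fx s y - vxx s y := by
    ext y; linarith [h.eqn s hs y]
  rw [this]
  exact ((h.continuous_vt hs).add (h.continuous_fx s hs)).sub (h.continuous_vxx s hs)

/-- The integral of the solution against the backward heat kernel, localized by the cutoff. -/
lemma hasDerivAt_integral_heatKernel_mul (h : IsHeatSolution v f g vt vx vxx fx)
    {a T s : ℝ} (ha : 0 < a) (hs : 0 < s) (hsT : s < T) (x : ℝ) :
    HasDerivAt (fun r => ∫ y in (-a)..a, heatKernel (T - r) (x - y) * cutoff a y * v r y)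
      (∫ y in (-a)..a,
        ((heatKernel (T - s) (x - y) * cutoffDxx a y
            - 2 * heatKernelDx (T - s) (x - y) * cutoffDx a y) * v s y
          + (heatKernel (T - s) (x - y) * cutoffDx a y
            - heatKernelDx (T - s) (x - y) * cutoff a y) * f s y
          + heatKernel (T - s) (x - y) * cutoff a y * g s y)) s := by
  have hτ : 0 < T - s := by linarith
  have hmaps : MapsTo (fun p : ℝ × ℝ => (T - p.1, x - p.2)) (Ioo 0 T ×ˢ univ)
      (Ioi 0 ×ˢ univ) := fun p hp => ⟨by simpa using hp.1.2, mem_univ _⟩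
  have hsub : Ioo 0 T ×ˢ (univ : Set ℝ) ⊆ Ioi 0 ×ˢ univ := prod_mono (fun _ h => h.1) le_rfl
  have hsub' : Ioo 0 T ×ˢ (univ : Set ℝ) ⊆ Ici 0 ×ˢ univ := prod_mono (fun _ h => h.1.le) le_rfl
  have cχ := continuous_cutoff a
  have cχ' := continuous_cutoffDx a
  have cχ'' := continuous_cutoffDxx a
  have cχ2 : Continuous fun p : ℝ × ℝ => cutoff a p.2 := cχ.comp continuous_snd
  have key := hasDerivAt_intervalIntegral_of_continuousOn (a := -a) (b := a) (s := s)
    (F := fun r y => heatKernel (T - r) (x - y) * cutoff a y * v r y)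
    (F' := fun r y => -heatKernelDxx (T - r) (x - y) * cutoff a y * v r y
      + heatKernel (T - r) (x - y) * cutoff a y * vt r y)
    (isOpen_Ioo (a := 0) (b := T)) ⟨hs, hsT⟩ ?_ ?_ ?_
  · refine key.congr_deriv ?_
    have cK : Continuous fun y => heatKernel (T - s) (x - y) :=
      (continuous_heatKernel _).comp (by fun_prop)
    have cK' : Continuous fun y => heatKernelDx (T - s) (x - y) :=
      (continuous_heatKernelDx _).comp (by fun_prop)
    have cK'' : Continuous fun y => heatKernelDxx (T - s) (x - y) :=
      (continuous_heatKernelDxx _).comp (by fun_prop)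
    have cv := h.continuous_slice hs.le
    have cvxx := h.continuous_vxx s hs
    have cvx : Continuous (vx s) :=
      continuous_iff_continuousAt.2 fun y => (h.hasDerivAt_vxx s hs y).continuousAt
    have cf := h.continuous_f hs
    have cfx := h.continuous_fx s hs
    have cg := h.continuous_g hs
    have cvt := h.continuous_vt hs
    have dK : ∀ y, HasDerivAt (fun y => heatKernel (T - s) (x - y))
        (-heatKernelDx (T - s) (x - y)) y := fun y =>
      (hasDerivAt_heatKernel hτ (x - y)).comp_const_sub x y
    have dK' : ∀ y, HasDerivAt (fun y => heatKernelDx (T - s) (x - y))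
        (-heatKernelDxx (T - s) (x - y)) y := fun y =>
      (hasDerivAt_heatKernelDx hτ (x - y)).comp_const_sub x y
    have dψ : ∀ y, HasDerivAt (fun y => heatKernel (T - s) (x - y) * cutoff a y)
        (heatKernel (T - s) (x - y) * cutoffDx a y
          - heatKernelDx (T - s) (x - y) * cutoff a y) y := fun y =>
      ((dK y).mul (hasDerivAt_cutoff a y)).congr_deriv (by ring)
    have dψ' : ∀ y, HasDerivAt (fun y => heatKernel (T - s) (x - y) * cutoffDx a y
          - heatKernelDx (T - s) (x - y) * cutoff a y)
        (heatKernel (T - s) (x - y) * cutoffDxx a y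
          - 2 * heatKernelDx (T - s) (x - y) * cutoffDx a y
          + heatKernelDxx (T - s) (x - y) * cutoff a y) y := fun y =>
      (((dK y).mul (hasDerivAt_cutoffDx a y)).sub
        ((dK' y).mul (hasDerivAt_cutoff a y))).congr_deriv (by ring)
    have hint : ∀ {F : ℝ → ℝ}, Continuous F → IntervalIntegrable F volume (-a) a :=
      fun hF => hF.intervalIntegrable _ _
    have ibp1 := intervalIntegral.integral_mul_deriv_eq_deriv_mul (a := -a) (b := a)
      (fun y _ => dψ y) (fun y _ => h.hasDerivAt_vxx s hs y)
      (hint (by fun_prop)) (hint cvxx)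
    have ibp2 := intervalIntegral.integral_mul_deriv_eq_deriv_mul (a := -a) (b := a)
      (fun y _ => dψ' y) (fun y _ => h.hasDerivAt_vx s hs y)
      (hint (by fun_prop)) (hint cvx)
    have ibp3 := intervalIntegral.integral_mul_deriv_eq_deriv_mul (a := -a) (b := a)
      (fun y _ => dψ y) (fun y _ => h.hasDerivAt_fx s hs y)
      (hint (by fun_prop)) (hint cfx)
    simp only [cutoff_right ha.ne', cutoff_left ha.ne', cutoffDx_right ha.ne',
      cutoffDx_left ha.ne', mul_zero, zero_mul, sub_zero, zero_sub] at ibp1 ibp2 ibp3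
    have e1 : ∀ y, -heatKernelDxx (T - s) (x - y) * cutoff a y * v s y
          + heatKernel (T - s) (x - y) * cutoff a y * vt s y
        = -heatKernelDxx (T - s) (x - y) * cutoff a y * v s y
          + heatKernel (T - s) (x - y) * cutoff a y * vxx s y
          - heatKernel (T - s) (x - y) * cutoff a y * fx s y
          + heatKernel (T - s) (x - y) * cutoff a y * g s y := fun y => by
      have := h.eqn s hs y
      rw [show vt s y = vxx s y + g s y - fx s y by linarith]
      ring
    simp_rw [e1]
    rw [intervalIntegral.integral_add (hint (by fun_prop)) (hint (by fun_prop)),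
      intervalIntegral.integral_sub (hint (by fun_prop)) (hint (by fun_prop)),
      intervalIntegral.integral_add (hint (by fun_prop)) (hint (by fun_prop)),
      ibp1, ibp2, ibp3, ← intervalIntegral.integral_neg, ← intervalIntegral.integral_neg,
      ← intervalIntegral.integral_neg,
      ← intervalIntegral.integral_add (hint (by fun_prop)) (hint (by fun_prop)),
      ← intervalIntegral.integral_sub (hint (by fun_prop)) (hint (by fun_prop)),
      ← intervalIntegral.integral_add (hint (by fun_prop)) (hint (by fun_prop))]
    refine intervalIntegral.integral_congr fun y _ => ?_
    ring
  · intro r hr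
    have cK : Continuous fun y => heatKernel (T - r) (x - y) :=
      (continuous_heatKernel _).comp (by fun_prop)
    have cv := h.continuous_slice hr.1.le
    fun_prop
  · exact (((continuousOn_heatKernelDxx.comp (by fun_prop) hmaps).neg.mul
      cχ2.continuousOn).mul (h.continuousOn.mono hsub')).add
      (((continuousOn_heatKernel.comp (by fun_prop) hmaps).mul cχ2.continuousOn).mul
        (h.continuousOn_vt.mono hsub))
  · intro r hr y
    have hr' : 0 < T - r := by linarith [hr.2]
    have d1 : HasDerivAt (fun r => heatKernel (T - r) (x - y))
        (-heatKernelDxx (T - r) (x - y)) r :=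
      (hasDerivAt_heatKernel_time hr' (x - y)).comp_const_sub T r
    exact (d1.mul_const (cutoff a y)).mul (h.hasDerivAt_vt r hr.1 y)

lemma integral_deriv_le (h : IsHeatSolution v f g vt vx vxx fx)
    {a τ s η B M N : ℝ} (ha : 0 < a) (hs : 0 < s) (hτ : 0 < τ) (hη : 0 ≤ η) (hB : 0 ≤ B)
    (hM : 0 ≤ M) (hN : 0 ≤ N)
    (hv : ∀ y, |v s y| ≤ B * expWeight η y)
    (hf : ∀ y, |f s y| ≤ M * (B * expWeight η y))
    (hg : ∀ y, |g s y| ≤ N * (B * expWeight η y)) (x : ℝ) :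
    ∫ y in (-a)..a,
        ((heatKernel τ (x - y) * cutoffDxx a y
            - 2 * heatKernelDx τ (x - y) * cutoffDx a y) * v s y
          + (heatKernel τ (x - y) * cutoffDx a y
            - heatKernelDx τ (x - y) * cutoff a y) * f s y
          + heatKernel τ (x - y) * cutoff a y * g s y)
      ≤ expWeight η x * B * ((8 / a + M) * ((√τ)⁻¹ * Real.exp (2 * τ))
        + (8 / a ^ 2 + 4 * M / a + N) * Real.exp τ) := by
  have cχ := continuous_cutoff a
  have cχ' := continuous_cutoffDx a
  have cχ'' := continuous_cutoffDxx a
  have cK := continuous_heatKernel τ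
  have cK' := continuous_heatKernelDx τ
  have cρ := continuous_expWeight η
  have cv := h.continuous_slice hs.le
  have cf := h.continuous_f hs
  have cg := h.continuous_g hs
  have hpt : ∀ y ∈ Icc (-a) a,
      (heatKernel τ (x - y) * cutoffDxx a y
            - 2 * heatKernelDx τ (x - y) * cutoffDx a y) * v s y
          + (heatKernel τ (x - y) * cutoffDx a y
            - heatKernelDx τ (x - y) * cutoff a y) * f s y
          + heatKernel τ (x - y) * cutoff a y * g s y
      ≤ (8 / a + M) * B * (|heatKernelDx τ (x - y)| * expWeight η y)
        + (8 / a ^ 2 + 4 * M / a + N) * B * (heatKernel τ (x - y) * expWeight η y) := by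
    intro y hy
    have b0 := cutoff_le_one ha hy
    have b0' := cutoff_nonneg a y
    have b1 := abs_cutoffDx_le ha hy
    have b2 := abs_cutoffDxx_le ha hy
    have bv := hv y
    have bf := hf y
    have bg := hg y
    have bK := heatKernel_nonneg τ (x - y)
    have bW : 0 ≤ B * expWeight η y := mul_nonneg hB (expWeight_nonneg hη y)
    set K := heatKernel τ (x - y)
    set D := heatKernelDx τ (x - y)
    set W := B * expWeight η y with hW
    have i1 : |(K * cutoffDxx a y - 2 * D * cutoffDx a y) * v s y|
        ≤ (K * (8 / a ^ 2) + 2 * |D| * (4 / a)) * W := by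
      rw [abs_mul]
      refine mul_le_mul ((abs_sub _ _).trans ?_) bv (abs_nonneg _) (by positivity)
      rw [abs_mul, abs_mul, abs_mul, abs_of_nonneg bK, abs_two]
      gcongr
    have i2 : |(K * cutoffDx a y - D * cutoff a y) * f s y|
        ≤ (K * (4 / a) + |D| * 1) * (M * W) := by
      rw [abs_mul]
      refine mul_le_mul ((abs_sub _ _).trans ?_) bf (abs_nonneg _) (by positivity)
      rw [abs_mul, abs_mul, abs_of_nonneg bK, abs_of_nonneg b0']
      gcongr
    have i3 : |K * cutoff a y * g s y| ≤ K * 1 * (N * W) := by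
      rw [abs_mul, abs_mul, abs_of_nonneg bK, abs_of_nonneg b0']
      gcongr
    have e : (8 / a + M) * B * (|D| * expWeight η y)
        + (8 / a ^ 2 + 4 * M / a + N) * B * (K * expWeight η y)
        = (K * (8 / a ^ 2) + 2 * |D| * (4 / a)) * W + (K * (4 / a) + |D| * 1) * (M * W)
          + K * 1 * (N * W) := by
      rw [hW]; ring
    rw [e]
    exact add_le_add (add_le_add ((le_abs_self _).trans i1) ((le_abs_self _).trans i2))
      ((le_abs_self _).trans i3)
  refine (intervalIntegral.integral_mono_on (by linarith)
    (Continuous.intervalIntegrable (by fun_prop) _ _)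
    (Continuous.intervalIntegrable (by fun_prop) _ _) hpt).trans ?_
  rw [intervalIntegral.integral_add (Continuous.intervalIntegrable (by fun_prop) _ _)
    (Continuous.intervalIntegrable (by fun_prop) _ _),
    intervalIntegral.integral_const_mul, intervalIntegral.integral_const_mul]
  have j1 := mul_le_mul_of_nonneg_left
    (intervalIntegral_abs_heatKernelDx_mul_expWeight_le hτ hη x ha.le)
    (show 0 ≤ (8 / a + M) * B by positivity)
  have j2 := mul_le_mul_of_nonneg_left
    (intervalIntegral_heatKernel_mul_expWeight_le hτ hη x ha.le)
    (show 0 ≤ (8 / a ^ 2 + 4 * M / a + N) * B by positivity)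
  refine (add_le_add j1 j2).trans (le_of_eq ?_)
  ring

/-- Localized Duhamel estimate. -/
lemma integral_heatKernel_mul_cutoff_le (h : IsHeatSolution v f g vt vx vxx fx)
    {a t ε η M : ℝ} {B N φ : ℝ → ℝ} (ha : 0 < a) (ht : 0 ≤ t) (hε : 0 < ε) (hη : 0 ≤ η)
    (hM : 0 ≤ M) (hB : ∀ s ∈ Ioo 0 t, 0 ≤ B s) (hN : ∀ s ∈ Ioo 0 t, 0 ≤ N s)
    (hv0 : ∀ y, |v 0 y| ≤ expWeight η y)
    (hv : ∀ s ∈ Ioo 0 t, ∀ y, |v s y| ≤ B s * expWeight η y)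
    (hf : ∀ s ∈ Ioo 0 t, ∀ y, |f s y| ≤ M * (B s * expWeight η y))
    (hg : ∀ s ∈ Ioo 0 t, ∀ y, |g s y| ≤ N s * (B s * expWeight η y)) (x : ℝ)
    (hφ : IntegrableOn φ (Icc 0 t))
    (hφ' : ∀ s ∈ Ioo 0 t,
      expWeight η x * B s * ((8 / a + M) * ((√(t + ε - s))⁻¹ * Real.exp (2 * (t + ε - s)))
        + (8 / a ^ 2 + 4 * M / a + N s) * Real.exp (t + ε - s)) ≤ φ s) :
    ∫ y in (-a)..a, heatKernel ε (x - y) * cutoff a y * v t y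
      ≤ Real.exp (t + ε) * expWeight η x + ∫ s in (0 : ℝ)..t, φ s := by
  have hmaps : MapsTo (fun p : ℝ × ℝ => (t + ε - p.1, x - p.2)) (Icc 0 t ×ˢ univ)
      (Ioi 0 ×ˢ univ) := fun p hp => by
    have := hp.1.2
    exact ⟨show 0 < t + ε - p.1 by linarith, mem_univ _⟩
  have cχ2 : Continuous fun p : ℝ × ℝ => cutoff a p.2 := (continuous_cutoff a).comp continuous_snd
  have hcont : ContinuousOn
      (fun r => ∫ y in (-a)..a, heatKernel (t + ε - r) (x - y) * cutoff a y * v r y)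
      (Icc 0 t) := by
    refine continuousOn_intervalIntegral_of_continuousOn
      (F := fun r y => heatKernel (t + ε - r) (x - y) * cutoff a y * v r y) ht ?_
    exact ((continuousOn_heatKernel.comp (by fun_prop) hmaps).mul cχ2.continuousOn).mul
      (h.continuousOn.mono (prod_mono (fun _ h => h.1) le_rfl))
  have key := intervalIntegral.sub_le_integral_of_hasDeriv_right_of_le ht hcont
    (fun s hs => (h.hasDerivAt_integral_heatKernel_mul (T := t + ε) ha hs.1
      (by linarith [hs.2]) x).hasDerivWithinAt) hφ
    (fun s hs => (h.integral_deriv_le (τ := t + ε - s) ha hs.1 (by linarith [hs.2]) hη (hB s hs)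
      hM (hN s hs) (hv s hs) (hf s hs) (hg s hs) x).trans (hφ' s hs))
  have hinit : ∫ y in (-a)..a, heatKernel (t + ε - 0) (x - y) * cutoff a y * v 0 y
      ≤ Real.exp (t + ε) * expWeight η x := by
    have cK := continuous_heatKernel (t + ε)
    have cχ := continuous_cutoff a
    have cρ := continuous_expWeight η
    have cv := h.continuous_slice le_rfl
    rw [sub_zero]
    refine (intervalIntegral.integral_mono_on (by linarith)
      (Continuous.intervalIntegrable (by fun_prop) _ _)
      (Continuous.intervalIntegrable (by fun_prop) _ _) fun y hy => ?_).trans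
      (intervalIntegral_heatKernel_mul_expWeight_le (by linarith) hη x ha.le)
    rw [mul_assoc]
    refine mul_le_mul_of_nonneg_left ?_ (heatKernel_nonneg _ _)
    calc cutoff a y * v 0 y ≤ cutoff a y * |v 0 y| :=
          mul_le_mul_of_nonneg_left (le_abs_self _) (cutoff_nonneg _ _)
      _ ≤ 1 * |v 0 y| := mul_le_mul_of_nonneg_right (cutoff_le_one ha hy) (abs_nonneg _)
      _ ≤ expWeight η y := by rw [one_mul]; exact hv0 y
  simp only [add_sub_cancel_left] at key
  linarith

end IsHeatSolution

lemma integral_inv_sqrt_mul_exp_le {L t ε : ℝ} (hL : 0 < L) (ht : 0 ≤ t) (hε : 0 < ε) :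
    ∫ s in (0 : ℝ)..t, (√(t + ε - s))⁻¹ * Real.exp (-(L * (t + ε - s))) ≤ Real.pi / √L := by
  have hcont : ContinuousOn (fun s => (√(t + ε - s))⁻¹ * Real.exp (-(L * (t + ε - s))))
      (Icc 0 t) := by
    refine ContinuousOn.mul (ContinuousOn.inv₀ (by fun_prop) fun s hs => ?_) (by fun_prop)
    exact (Real.sqrt_pos.2 (by linarith [hs.2])).ne'
  have hsL : 0 < √L := Real.sqrt_pos.2 hL
  have key := intervalIntegral.integral_le_sub_of_hasDeriv_right_of_le ht
    (g := fun s => -(2 / √L) * Real.arctan √(L * (t + ε - s)))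
    (g' := fun s => (√(t + ε - s))⁻¹ * (1 + L * (t + ε - s))⁻¹)
    (φ := fun s => (√(t + ε - s))⁻¹ * Real.exp (-(L * (t + ε - s))))
    (by fun_prop)
    (fun s hs => ?_) hcont.integrableOn_Icc (fun s hs => ?_)
  · refine key.trans ?_
    have h1 := (Real.arctan_lt_pi_div_two √(L * (t + ε - 0))).le
    have h2 : 0 ≤ Real.arctan √(L * (t + ε - t)) := Real.arctan_nonneg.2 (Real.sqrt_nonneg _)
    have h3 : 0 < 2 / √L := by positivity
    have e : Real.pi / √L = 2 / √L * (Real.pi / 2) := by ring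
    rw [e]
    nlinarith
  · have hτ : 0 < t + ε - s := by linarith [hs.2]
    have hLτ : 0 < L * (t + ε - s) := by positivity
    have d1 : HasDerivAt (fun s => L * (t + ε - s)) (-L) s := by
      refine (((hasDerivAt_id s).const_sub (t + ε)).const_mul L).congr_deriv ?_
      ring
    refine ((((d1.sqrt hLτ.ne').arctan).const_mul (-(2 / √L))).congr_deriv ?_).hasDerivWithinAt
    rw [Real.sq_sqrt hLτ.le, Real.sqrt_mul hL.le]
    have : 0 < √(t + ε - s) := Real.sqrt_pos.2 hτ
    have e : √L * √L = L := Real.mul_self_sqrt hL.le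
    have : (1 + L * (t + ε - s)) ≠ 0 := by positivity
    field_simp
    linarith [e]
  · have hτ : 0 < t + ε - s := by linarith [hs.2]
    refine mul_le_mul_of_nonneg_left ?_ (by positivity)
    rw [Real.exp_neg]
    exact inv_anti₀ (by positivity) (by linarith [Real.add_one_le_exp (L * (t + ε - s))])

lemma tendsto_integral_heatKernel_mul_cutoff {w : ℝ → ℝ} (hw : Continuous w) {M : ℝ}
    (hM : ∀ y, |w y| ≤ M) (x : ℝ) :
    Tendsto (fun ε : ℝ => ∫ y in (-ε⁻¹)..ε⁻¹, heatKernel ε (x - y) * cutoff ε⁻¹ y * w y)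
      (𝓝[>] 0) (𝓝 (w x)) := by
  have hM0 : 0 ≤ M := (abs_nonneg _).trans (hM 0)
  set H : ℝ → ℝ → ℝ := fun ε => (Ioc (-ε⁻¹) ε⁻¹).indicator fun y => cutoff ε⁻¹ y * w y with hH
  have hHm : ∀ ε, Measurable (H ε) := fun ε =>
    (((continuous_cutoff _).mul hw).measurable).indicator measurableSet_Ioc
  have hrew : ∀ ε ∈ Ioi (0 : ℝ),
      ∫ u, heatKernel 1 u * H ε (x - √ε * u)
        = ∫ y in (-ε⁻¹)..ε⁻¹, heatKernel ε (x - y) * cutoff ε⁻¹ y * w y := by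
    intro ε hε
    have hε : 0 < ε := hε
    have hs : 0 < √ε := Real.sqrt_pos.2 hε
    have e1 : ∀ u, heatKernel 1 u = √ε * heatKernel ε (√ε * u) := by
      intro u
      unfold heatKernel
      rw [Real.sqrt_mul (by positivity) ε, mul_pow, Real.sq_sqrt hε.le, mul_one, mul_one]
      rw [show -(ε * u ^ 2) / (4 * ε) = -u ^ 2 / 4 by field_simp]
      field_simp
    simp_rw [e1, mul_assoc]
    rw [integral_const_mul,
      Measure.integral_comp_mul_left (fun r => heatKernel ε r * H ε (x - r)) √ε,
      abs_of_pos (inv_pos.2 hs), smul_eq_mul, mul_inv_cancel_left₀ hs.ne',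
      ← integral_sub_left_eq_self (fun r => heatKernel ε r * H ε (x - r)) volume x,
      intervalIntegral.integral_of_le (by linarith [inv_pos.2 hε]),
      ← integral_indicator measurableSet_Ioc]
    refine integral_congr_ae (ae_of_all _ fun y => ?_)
    simp only [hH, sub_sub_cancel]
    by_cases hy : y ∈ Ioc (-ε⁻¹) ε⁻¹ <;> simp [hy]
  have hlim : Tendsto (fun ε : ℝ => ∫ u, heatKernel 1 u * H ε (x - √ε * u)) (𝓝[>] 0)
      (𝓝 (∫ u, heatKernel 1 u * w x)) := by
    refine tendsto_integral_filter_of_dominated_convergence (fun u => heatKernel 1 u * M) ?_ ?_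
      ((integrable_heatKernel one_pos).mul_const M) ?_
    · refine Eventually.of_forall fun ε => ?_
      exact ((continuous_heatKernel 1).measurable.mul
        ((hHm ε).comp (by fun_prop))).aestronglyMeasurable
    · filter_upwards [self_mem_nhdsWithin] with ε hε
      refine ae_of_all _ fun u => ?_
      rw [norm_mul, Real.norm_of_nonneg (heatKernel_nonneg _ _)]
      refine mul_le_mul_of_nonneg_left ?_ (heatKernel_nonneg _ _)
      simp only [hH]
      by_cases hy : x - √ε * u ∈ Ioc (-ε⁻¹) ε⁻¹
      · rw [indicator_of_mem hy, norm_mul, Real.norm_of_nonneg (cutoff_nonneg _ _)]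
        calc _ ≤ 1 * M := mul_le_mul (cutoff_le_one (inv_pos.2 hε) (Ioc_subset_Icc_self hy))
              (hM _) (abs_nonneg _) zero_le_one
          _ = M := one_mul M
      · rw [indicator_of_notMem hy]
        simpa using hM0
    · refine ae_of_all _ fun u => Tendsto.const_mul _ ?_
      have harg : Tendsto (fun ε : ℝ => x - √ε * u) (𝓝[>] 0) (𝓝 x) := by
        have : Continuous fun ε : ℝ => x - √ε * u := by fun_prop
        simpa using (this.tendsto 0).mono_left nhdsWithin_le_nhds
      have hinv : Tendsto (fun ε : ℝ => ε⁻¹) (𝓝[>] 0) atTop := tendsto_inv_nhdsGT_zero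
      have hid : Tendsto (fun ε : ℝ => ε) (𝓝[>] 0) (𝓝 0) :=
        tendsto_id.mono_left nhdsWithin_le_nhds
      have hmem : ∀ᶠ ε : ℝ in 𝓝[>] 0, x - √ε * u ∈ Ioc (-ε⁻¹) ε⁻¹ := by
        have hb : ∀ᶠ ε : ℝ in 𝓝[>] 0, x - √ε * u ∈ Ioo (x - 1) (x + 1) :=
          harg (Ioo_mem_nhds (by linarith) (by linarith))
        filter_upwards [hb, hinv.eventually_ge_atTop (|x| + 1)] with ε h1 h2
        have := neg_abs_le x
        have := le_abs_self x
        exact ⟨by linarith [h1.1], by linarith [h1.2]⟩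
      have hcut : Tendsto (fun ε : ℝ => cutoff ε⁻¹ (x - √ε * u)) (𝓝[>] 0) (𝓝 1) := by
        have : Tendsto (fun ε : ℝ => (1 - ((x - √ε * u) * ε) ^ 2) ^ 2) (𝓝[>] 0)
            (𝓝 ((1 - (x * 0) ^ 2) ^ 2)) :=
          ((((harg.mul hid).pow 2).const_sub 1).pow 2)
        simpa [cutoff, div_inv_eq_mul] using this
      have := hcut.mul ((hw.tendsto x).comp harg)
      rw [one_mul] at this
      refine this.congr' ?_
      filter_upwards [hmem] with ε hε
      simp only [hH, indicator_of_mem hε, Function.comp_apply]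
  rw [integral_mul_const, integral_heatKernel one_pos, one_mul] at hlim
  refine hlim.congr' ?_
  filter_upwards [self_mem_nhdsWithin] with ε hε using hrew ε hε

namespace IsHeatSolution

variable {v f g vt vx vxx fx : ℝ → ℝ → ℝ}

lemma neg (h : IsHeatSolution v f g vt vx vxx fx) :
    IsHeatSolution (fun s y => -v s y) (fun s y => -f s y) (fun s y => -g s y)
      (fun s y => -vt s y) (fun s y => -vx s y) (fun s y => -vxx s y) (fun s y => -fx s y) where
  continuousOn := h.continuousOn.neg
  continuousOn_vt := h.continuousOn_vt.neg
  hasDerivAt_vt s hs y := (h.hasDerivAt_vt s hs y).neg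
  hasDerivAt_vx s hs y := (h.hasDerivAt_vx s hs y).neg
  hasDerivAt_vxx s hs y := (h.hasDerivAt_vxx s hs y).neg
  continuous_vxx s hs := (h.continuous_vxx s hs).neg
  hasDerivAt_fx s hs y := (h.hasDerivAt_fx s hs y).neg
  continuous_fx s hs := (h.continuous_fx s hs).neg
  eqn s hs y := by linarith [h.eqn s hs y]

lemma integral_heatKernel_mul_cutoff_le_exp (h : IsHeatSolution v f g vt vx vxx fx)
    {a t ε η M L K : ℝ} {V : ℝ → ℝ} (ha : 0 < a) (ht : 0 ≤ t) (hε : 0 < ε) (hη : 0 ≤ η)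
    (hM : 0 ≤ M) (hL : 0 < L) (hK : 0 ≤ K)
    (hV : IntervalIntegrable V volume 0 t) (hV0 : ∀ s, 0 ≤ V s)
    (hv0 : ∀ y, |v 0 y| ≤ expWeight η y)
    (hv : ∀ s ∈ Ioo 0 t, ∀ y,
      |v s y| ≤ K * Real.exp ((L + 2) * s + ∫ r in (0 : ℝ)..s, V r) * expWeight η y)
    (hf : ∀ s ∈ Ioo 0 t, ∀ y,
      |f s y| ≤ M * (K * Real.exp ((L + 2) * s + ∫ r in (0 : ℝ)..s, V r) * expWeight η y))
    (hg : ∀ s ∈ Ioo 0 t, ∀ y, |g s y| ≤ V s / 2 *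
      (K * Real.exp ((L + 2) * s + ∫ r in (0 : ℝ)..s, V r) * expWeight η y)) (x : ℝ) :
    ∫ y in (-a)..a, heatKernel ε (x - y) * cutoff a y * v t y
      ≤ expWeight η x * (Real.exp (t + ε) + K * Real.exp ((L + 2) * (t + ε)) *
        (Real.exp (∫ r in (0 : ℝ)..t, V r) *
            ((8 / a + M) * (Real.pi / √L) + (8 / a ^ 2 + 4 * M / a) * t)
          + (Real.exp (∫ r in (0 : ℝ)..t, V r) - 1) / 2)) := by
  set J : ℝ → ℝ := fun s => ∫ r in (0 : ℝ)..s, V r with hJ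
  have hρ := expWeight_nonneg hη x
  set P := K * Real.exp ((L + 2) * (t + ε)) with hP
  have hP0 : 0 ≤ P := by positivity
  set c1 := 8 / a + M with hc1
  have hc10 : 0 ≤ c1 := by positivity
  set c2 := 8 / a ^ 2 + 4 * M / a with hc2
  have hc20 : 0 ≤ c2 := by positivity
  have iI : IntervalIntegrable
      (fun s => (√(t + ε - s))⁻¹ * Real.exp (-(L * (t + ε - s)))) volume 0 t := by
    refine ContinuousOn.intervalIntegrable_of_Icc ht
      (ContinuousOn.mul (ContinuousOn.inv₀ (by fun_prop) fun s hs => ?_) (by fun_prop))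
    exact (Real.sqrt_pos.2 (by linarith [hs.2])).ne'
  have cJ : ContinuousOn J (uIcc 0 t) :=
    (hV.absolutelyContinuousOnInterval_intervalIntegral (c := 0) (by simp)).continuousOn
  have iV : IntervalIntegrable (fun s => V s * Real.exp (J s)) volume 0 t :=
    hV.mul_continuousOn (Real.continuous_exp.comp_continuousOn cJ)
  have i1 := (iI.const_mul (P * Real.exp (J t) * c1)).add
    (intervalIntegrable_const (c := P * Real.exp (J t) * c2))
  have i2 := iV.const_mul (P / 2)
  have iφ := (i1.add i2).const_mul (expWeight η x)
  have hmono : ∀ s ∈ Ioo 0 t, J s ≤ J t := by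
    intro s hs
    refine intervalIntegral.integral_mono_interval le_rfl hs.1.le hs.2.le
      (ae_of_all _ hV0) hV
  refine (h.integral_heatKernel_mul_cutoff_le ha ht hε hη hM (fun s _ => by positivity)
    (fun s _ => div_nonneg (hV0 s) zero_le_two) hv0 hv hf hg x
    ((intervalIntegrable_iff_integrableOn_Icc_of_le ht).1 iφ) fun s hs => ?_).trans ?_
  · have hJs := Real.exp_le_exp.2 (hmono s hs)
    set τ := t + ε - s with hτ
    have hτ0 : 0 < τ := by linarith [hs.2]
    have e1 : K * Real.exp ((L + 2) * s + J s) * Real.exp (2 * τ)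
        = P * Real.exp (J s) * Real.exp (-(L * τ)) := by
      rw [hP, mul_assoc, mul_assoc, mul_assoc, ← Real.exp_add, ← Real.exp_add, ← Real.exp_add]
      congr 2
      rw [hτ]; ring
    have e2 : K * Real.exp ((L + 2) * s + J s) * Real.exp τ ≤ P * Real.exp (J s) := by
      rw [hP, mul_assoc, mul_assoc, ← Real.exp_add, ← Real.exp_add]
      refine mul_le_mul_of_nonneg_left (Real.exp_le_exp.2 ?_) hK
      have : 0 ≤ (L + 1) * τ := by positivity
      have : (L + 2) * (t + ε) = (L + 2) * s + (L + 2) * τ := by rw [hτ]; ring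
      linarith
    have hV0s := hV0 s
    calc expWeight η x * (K * Real.exp ((L + 2) * s + J s)) *
          (c1 * ((√τ)⁻¹ * Real.exp (2 * τ)) + (c2 + V s / 2) * Real.exp τ)
        = expWeight η x * (c1 * (√τ)⁻¹ *
            (K * Real.exp ((L + 2) * s + J s) * Real.exp (2 * τ))
          + (c2 + V s / 2) * (K * Real.exp ((L + 2) * s + J s) * Real.exp τ)) := by ring
      _ ≤ expWeight η x * (c1 * (√τ)⁻¹ * (P * Real.exp (J s) * Real.exp (-(L * τ)))
          + (c2 + V s / 2) * (P * Real.exp (J s))) := by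
        rw [e1]; gcongr
      _ = expWeight η x * (c1 * (√τ)⁻¹ * (P * Real.exp (J s) * Real.exp (-(L * τ)))
          + c2 * (P * Real.exp (J s)) + P / 2 * (V s * Real.exp (J s))) := by ring
      _ ≤ expWeight η x * (c1 * (√τ)⁻¹ * (P * Real.exp (J t) * Real.exp (-(L * τ)))
          + c2 * (P * Real.exp (J t)) + P / 2 * (V s * Real.exp (J s))) := by gcongr
      _ = _ := by ring
  · have hI := integral_inv_sqrt_mul_exp_le hL ht hε
    have hval : ∫ s in (0 : ℝ)..t, expWeight η x *
        ((P * Real.exp (J t) * c1 * ((√(t + ε - s))⁻¹ * Real.exp (-(L * (t + ε - s))))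
          + P * Real.exp (J t) * c2) + P / 2 * (V s * Real.exp (J s)))
        = expWeight η x * ((P * Real.exp (J t) * c1 *
          (∫ s in (0 : ℝ)..t, (√(t + ε - s))⁻¹ * Real.exp (-(L * (t + ε - s))))
          + t * (P * Real.exp (J t) * c2)) + P / 2 * (Real.exp (J t) - 1)) := by
      have hp : ∫ s in (0 : ℝ)..t, V s * Real.exp (J s) = Real.exp (J t) - 1 :=
        integral_mul_exp_primitive hV
      rw [intervalIntegral.integral_const_mul, intervalIntegral.integral_add i1 i2,
        intervalIntegral.integral_add (iI.const_mul _) intervalIntegrable_const,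
        intervalIntegral.integral_const_mul, intervalIntegral.integral_const_mul (P / 2),
        intervalIntegral.integral_const, hp, sub_zero, smul_eq_mul]
    refine (add_le_add le_rfl (hval.le.trans (mul_le_mul_of_nonneg_left (add_le_add
      (add_le_add (mul_le_mul_of_nonneg_left hI (show 0 ≤ P * Real.exp (J t) * c1 by positivity))
        le_rfl) le_rfl) hρ))).trans (le_of_eq ?_)
    ring

/-- The a priori bound with constant `K` improves to one with constant `3 K / 4`. -/
lemma le_of_bound (h : IsHeatSolution v f g vt vx vxx fx)
    {t η M L K M' : ℝ} {V : ℝ → ℝ} (ht : 0 ≤ t) (hη : 0 ≤ η)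
    (hM : 0 ≤ M) (hL : 0 < L) (hML : M * (Real.pi / √L) ≤ 1 / 4) (hK : 2 ≤ K)
    (hV : IntervalIntegrable V volume 0 t) (hV0 : ∀ s, 0 ≤ V s)
    (hbdd : ∀ y, |v t y| ≤ M')
    (hv0 : ∀ y, |v 0 y| ≤ expWeight η y)
    (hv : ∀ s ∈ Ioo 0 t, ∀ y,
      |v s y| ≤ K * Real.exp ((L + 2) * s + ∫ r in (0 : ℝ)..s, V r) * expWeight η y)
    (hf : ∀ s ∈ Ioo 0 t, ∀ y,
      |f s y| ≤ M * (K * Real.exp ((L + 2) * s + ∫ r in (0 : ℝ)..s, V r) * expWeight η y))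
    (hg : ∀ s ∈ Ioo 0 t, ∀ y, |g s y| ≤ V s / 2 *
      (K * Real.exp ((L + 2) * s + ∫ r in (0 : ℝ)..s, V r) * expWeight η y)) (x : ℝ) :
    v t x ≤ 3 / 4 * K * Real.exp ((L + 2) * t + ∫ r in (0 : ℝ)..t, V r) * expWeight η x := by
  set J := ∫ r in (0 : ℝ)..t, V r with hJ
  have hρ := expWeight_nonneg hη x
  have hlim : Tendsto (fun ε : ℝ => expWeight η x * (Real.exp (t + ε)
        + K * Real.exp ((L + 2) * (t + ε)) *
        (Real.exp J * ((8 * ε + M) * (Real.pi / √L) + (8 * ε ^ 2 + 4 * M * ε) * t)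
          + (Real.exp J - 1) / 2))) (𝓝[>] 0)
      (𝓝 (expWeight η x * (Real.exp t + K * Real.exp ((L + 2) * t) *
        (Real.exp J * (M * (Real.pi / √L)) + (Real.exp J - 1) / 2)))) := by
    refine ((Continuous.tendsto' ?_ 0 _ ?_)).mono_left nhdsWithin_le_nhds
    · fun_prop
    · simp
  have hle := le_of_tendsto_of_tendsto
    (tendsto_integral_heatKernel_mul_cutoff (h.continuous_slice ht) hbdd x) hlim (by
      filter_upwards [self_mem_nhdsWithin] with ε hε
      have := h.integral_heatKernel_mul_cutoff_le_exp (inv_pos.2 hε) ht hε hη hM hL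
        (by linarith) hV hV0 hv0 hv hf hg x
      simpa only [div_inv_eq_mul, inv_pow] using this)
  refine hle.trans ?_
  rw [mul_comm _ (expWeight η x), Real.exp_add]
  refine mul_le_mul_of_nonneg_left ?_ hρ
  have hE : Real.exp t ≤ Real.exp ((L + 2) * t) := Real.exp_le_exp.2 (by nlinarith)
  have hEpos := Real.exp_pos ((L + 2) * t)
  set E := Real.exp ((L + 2) * t)
  have hJpos := Real.exp_pos J
  have h1 : K * E * (Real.exp J * (M * (Real.pi / √L)))
      ≤ K * E * (Real.exp J * (1 / 4)) := by
    have : 0 ≤ K * E := by positivity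
    gcongr
  have h2 : 0 ≤ E * (K / 2 - 1) := mul_nonneg hEpos.le (by linarith)
  linarith

lemma of_contDiffOn {v f : ℝ → ℝ → ℝ}
    (hv : ContDiffOn ℝ (⊤ : ℕ∞) (fun p : ℝ × ℝ => v p.1 p.2) (Ici (0 : ℝ) ×ˢ (univ : Set ℝ)))
    (hf : ContDiffOn ℝ (⊤ : ℕ∞) (fun p : ℝ × ℝ => f p.1 p.2) (Ici (0 : ℝ) ×ˢ (univ : Set ℝ))) :
    IsHeatSolution v f
      (fun s y => deriv (fun r => v r y) s + deriv (f s) y - deriv (deriv (v s)) y)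
      (fun s y => deriv (fun r => v r y) s) (fun s => deriv (v s))
      (fun s => deriv (deriv (v s))) (fun s => deriv (f s)) := by
  have hsub : Ioi (0 : ℝ) ×ˢ (univ : Set ℝ) ⊆ Ici 0 ×ˢ univ :=
    prod_mono Ioi_subset_Ici_self le_rfl
  have hopen : IsOpen (Ioi (0 : ℝ) ×ˢ (univ : Set ℝ)) := isOpen_Ioi.prod isOpen_univ
  have hslice : ∀ {w : ℝ → ℝ → ℝ},
      ContDiffOn ℝ (⊤ : ℕ∞) (fun p : ℝ × ℝ => w p.1 p.2) (Ici (0 : ℝ) ×ˢ (univ : Set ℝ)) →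
      ∀ s > 0, ContDiff ℝ (⊤ : ℕ∞) (w s) := by
    intro w hw s hs
    have hc : ContDiff ℝ (⊤ : ℕ∞) fun y : ℝ => (s, y) := contDiff_const.prodMk contDiff_id
    exact hw.comp_contDiff hc fun y => ⟨le_of_lt hs, mem_univ _⟩
  have hderiv : ∀ s > 0, ∀ y, HasDerivAt (fun r => v r y)
      (fderiv ℝ (fun p : ℝ × ℝ => v p.1 p.2) (s, y) (1, 0)) s := by
    intro s hs y
    have hd : DifferentiableAt ℝ (fun p : ℝ × ℝ => v p.1 p.2) (s, y) :=
      ((hv.mono hsub).contDiffAt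
        (hopen.mem_nhds (show ((s, y) : ℝ × ℝ) ∈ Ioi (0 : ℝ) ×ˢ univ from
          ⟨hs, mem_univ _⟩))).differentiableAt (by simp)
    exact hd.hasFDerivAt.comp_hasDerivAt (f := fun r => (r, y)) s
      ((hasDerivAt_id s).prodMk (hasDerivAt_const s y))
  refine ⟨hv.continuousOn, ?_, fun s hs y => ?_, fun s hs y => ?_, fun s hs y => ?_,
    fun s hs => ?_, fun s hs y => ?_, fun s hs => ?_, fun s hs y => by ring⟩
  · have : ContinuousOn (fun p : ℝ × ℝ => fderiv ℝ (fun p : ℝ × ℝ => v p.1 p.2) p (1, 0))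
        (Ioi 0 ×ˢ univ) :=
      ((hv.mono hsub).continuousOn_fderiv_of_isOpen hopen (by simp)).clm_apply continuousOn_const
    exact this.congr fun p hp => (hderiv p.1 hp.1 p.2).deriv
  · exact (hderiv s hs y).differentiableAt.hasDerivAt
  · exact ((hslice hv s hs).differentiable (by simp) y).hasDerivAt
  · have := (contDiff_infty_iff_deriv.1 (hslice hv s hs)).2
    exact (this.differentiable (by simp) y).hasDerivAt
  · have := (contDiff_infty_iff_deriv.1 (hslice hv s hs)).2
    exact this.continuous_deriv (by simp)
  · exact ((hslice hf s hs).differentiable (by simp) y).hasDerivAt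
  · exact (hslice hf s hs).continuous_deriv (by simp)

end IsHeatSolution

/-- A monotone family of properties that improves from `K` to `3 K / 4` as long as `2 ≤ K` holds at
`2` once it holds somewhere. -/
lemma of_improvement {Q : ℝ → Prop} (hQ : ∀ K K', K ≤ K' → Q K → Q K')
    (hstep : ∀ K, 2 ≤ K → Q K → Q (3 / 4 * K)) {K : ℝ} (hK : Q K) : Q 2 := by
  have hn : ∀ n : ℕ, Q (max 2 ((3 / 4) ^ n * K)) := by
    intro n
    induction n with
    | zero => exact hQ _ _ (by simp) hK
    | succ n ih =>
      refine hQ _ _ ?_ (hstep _ (le_max_left _ _) ih)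
      rw [mul_max_of_nonneg _ _ (by norm_num), pow_succ']
      exact max_le_max (by norm_num) (by rw [mul_assoc])
  have hlim : Tendsto (fun n : ℕ => (3 / 4 : ℝ) ^ n * K) atTop (𝓝 0) := by
    simpa using (tendsto_pow_atTop_nhds_zero_of_lt_one (by norm_num : (0 : ℝ) ≤ 3 / 4)
      (by norm_num)).mul_const K
  obtain ⟨n, h⟩ := (hlim.eventually (gt_mem_nhds (by norm_num : (0 : ℝ) < 2))).exists
  simpa [max_eq_left h.le] using hn n

/-- A solution of `z_t + F_x - z_xx = G` bounded by the flux and source estimates of the linearized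
equation decays exponentially in space. -/
lemma norm_le_of_isHeatSolution {n : ℕ} {z f g zt zx zxx fx : ℝ → ℝ → Fin n → ℝ}
    (h : ∀ i, IsHeatSolution (fun s y => z s y i) (fun s y => f s y i) (fun s y => g s y i)
      (fun s y => zt s y i) (fun s y => zx s y i) (fun s y => zxx s y i) (fun s y => fx s y i))
    {M L T M' : ℝ} {V : ℝ → ℝ} (hM : 0 ≤ M) (hL : 0 < L) (hML : M * (Real.pi / √L) ≤ 1 / 4)
    (hT : 0 ≤ T) (hV : IntervalIntegrable V volume 0 T) (hV0 : ∀ s, 0 ≤ V s)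
    (hbdd : ∀ t ∈ Icc 0 T, ∀ x, ‖z t x‖ ≤ M')
    (hf : ∀ s > 0, ∀ y, ‖f s y‖ ≤ M * ‖z s y‖) (hg : ∀ s > 0, ∀ y, ‖g s y‖ ≤ V s / 2 * ‖z s y‖)
    (hneg : ∀ x ≤ 0, ‖z 0 x‖ ≤ 1) (hpos : ∀ x > 0, z 0 x = 0) (x : ℝ) :
    ‖z T x‖ ≤ 2 * Real.exp ((L + 2) * T + (∫ r in (0 : ℝ)..T, V r) - x) := by
  have hVt : ∀ t ∈ Icc 0 T, IntervalIntegrable V volume 0 t := fun t ht =>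
    hV.mono_set (by rw [uIcc_of_le ht.1, uIcc_of_le hT]; exact Icc_subset_Icc_right ht.2)
  have hJ0 : ∀ t ∈ Icc 0 T, 0 ≤ ∫ r in (0 : ℝ)..t, V r := fun t ht =>
    intervalIntegral.integral_nonneg ht.1 fun s _ => hV0 s
  have hM'0 : 0 ≤ M' := (norm_nonneg _).trans (hbdd 0 ⟨le_rfl, hT⟩ 0)
  have hη : ∀ η > 0, ∀ t ∈ Icc 0 T, ∀ x,
      ‖z t x‖ ≤ 2 * Real.exp ((L + 2) * t + ∫ r in (0 : ℝ)..t, V r) * expWeight η x := by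
    intro η hη
    have hz0 : ∀ y, ‖z 0 y‖ ≤ expWeight η y := by
      intro y
      rcases le_or_gt y 0 with hy | hy
      · have := Real.one_le_exp (neg_nonneg.2 hy)
        have := hneg y hy
        unfold expWeight
        linarith
      · rw [hpos y hy, norm_zero]
        exact expWeight_nonneg hη.le y
    refine of_improvement (Q := fun K => ∀ t ∈ Icc 0 T, ∀ x,
      ‖z t x‖ ≤ K * Real.exp ((L + 2) * t + ∫ r in (0 : ℝ)..t, V r) * expWeight η x)
      (fun K K' hK hQ t ht x => (hQ t ht x).trans ?_) (fun K hK hQ t ht x => ?_) (K := M' / η)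
      fun t ht x => ?_
    · have := expWeight_nonneg hη.le x
      gcongr
    · have hw := expWeight_nonneg hη.le x
      have hmem : ∀ s ∈ Ioo 0 t, s ∈ Icc 0 T := fun s hs => ⟨hs.1.le, hs.2.le.trans ht.2⟩
      refine (pi_norm_le_iff_of_nonneg (by positivity)).2 fun i => abs_le'.2 ⟨?_, ?_⟩
      · refine (h i).le_of_bound ht.1 hη.le hM hL hML hK (hVt t ht) hV0
          (fun y => (norm_le_pi_norm _ i).trans (hbdd t ht y))
          (fun y => (norm_le_pi_norm _ i).trans (hz0 y))
          (fun s hs y => (norm_le_pi_norm _ i).trans (hQ s (hmem s hs) y))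
          (fun s hs y => ?_) (fun s hs y => ?_) x
        · exact (norm_le_pi_norm _ i).trans ((hf s hs.1 y).trans
            (mul_le_mul_of_nonneg_left (hQ s (hmem s hs) y) hM))
        · exact (norm_le_pi_norm _ i).trans ((hg s hs.1 y).trans
            (mul_le_mul_of_nonneg_left (hQ s (hmem s hs) y) (div_nonneg (hV0 s) zero_le_two)))
      · refine (h i).neg.le_of_bound ht.1 hη.le hM hL hML hK (hVt t ht) hV0
          (fun y => (abs_neg _).trans_le ((norm_le_pi_norm _ i).trans (hbdd t ht y)))
          (fun y => (abs_neg _).trans_le ((norm_le_pi_norm _ i).trans (hz0 y)))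
          (fun s hs y => (abs_neg _).trans_le
            ((norm_le_pi_norm _ i).trans (hQ s (hmem s hs) y)))
          (fun s hs y => (abs_neg _).trans_le ?_) (fun s hs y => (abs_neg _).trans_le ?_) x
        · exact (norm_le_pi_norm _ i).trans ((hf s hs.1 y).trans
            (mul_le_mul_of_nonneg_left (hQ s (hmem s hs) y) hM))
        · exact (norm_le_pi_norm _ i).trans ((hg s hs.1 y).trans
            (mul_le_mul_of_nonneg_left (hQ s (hmem s hs) y) (div_nonneg (hV0 s) zero_le_two)))
    · have h1 : 1 ≤ Real.exp ((L + 2) * t + ∫ r in (0 : ℝ)..t, V r) := by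
        have := mul_nonneg (by linarith : 0 ≤ L + 2) ht.1
        exact Real.one_le_exp (add_nonneg this (hJ0 t ht))
      have h2 : η ≤ expWeight η x := by
        unfold expWeight
        linarith [Real.exp_pos (-x)]
      calc ‖z t x‖ ≤ M' := hbdd t ht x
        _ = M' / η * 1 * η := by field_simp
        _ ≤ _ := by gcongr
  have hlim : Tendsto (fun η : ℝ =>
      2 * Real.exp ((L + 2) * T + ∫ r in (0 : ℝ)..T, V r) * expWeight η x) (𝓝[>] 0)
      (𝓝 (2 * Real.exp ((L + 2) * T + ∫ r in (0 : ℝ)..T, V r) * Real.exp (-x))) := by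
    refine (Continuous.tendsto' ?_ 0 _ ?_).mono_left nhdsWithin_le_nhds
    · unfold expWeight
      fun_prop
    · simp [expWeight]
  have := ge_of_tendsto hlim (by
    filter_upwards [self_mem_nhdsWithin] with η h using hη η h T ⟨hT, le_rfl⟩ x)
  rwa [mul_assoc, ← Real.exp_add, ← sub_eq_add_neg] at this

/-- estimate (12.6) of Bianchini–Bressan.  A bounded solution of the
linearized equation `z_t + (A(u)z)_x + [DA(u)·z]u_x − [DA(u)·u_x]z = z_xx`, with data supported
in `{x ≤ 0}` and bounded by `1`, decays like
`|z(t,x)| ≤ 2 exp{Ct + 4‖DA‖_{L∞} ∫₀ᵗ ‖u_x(s)‖_{L∞} ds + t − x}`, where `C` depends only on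
`‖A‖_{L∞}`. -/
theorem linearized_exponential_decay (MA : ℝ) (hMA : 0 ≤ MA) :
    ∃ C > (0:ℝ),
      ∀ (n : ℕ) (A : (Fin n → ℝ) → ((Fin n → ℝ) →L[ℝ] (Fin n → ℝ))),
        ContDiff ℝ (⊤ : ℕ∞) A → (∀ ω : Fin n → ℝ, ‖A ω‖ ≤ MA) →
        ∀ MDA : ℝ, (∀ ω : Fin n → ℝ, ‖fderiv ℝ A ω‖ ≤ MDA) →
        ∀ u z : ℝ → ℝ → (Fin n → ℝ),
          -- `u`, `z` smooth on `[0,∞) × ℝ`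
          ContDiffOn ℝ (⊤ : ℕ∞) (fun p : ℝ × ℝ => u p.1 p.2) (Ici (0:ℝ) ×ˢ (univ : Set ℝ)) →
          ContDiffOn ℝ (⊤ : ℕ∞) (fun p : ℝ × ℝ => z p.1 p.2) (Ici (0:ℝ) ×ˢ (univ : Set ℝ)) →
          -- `s ↦ ‖u_x(s)‖_{L∞}` well defined and locally integrable
          (∀ s : ℝ, BddAbove (range fun x => ‖pdx u s x‖)) →
          (∀ T > (0:ℝ), IntervalIntegrable (fun s => ⨆ x : ℝ, ‖pdx u s x‖) volume 0 T) →
          -- `z` bounded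
          (∀ T > (0:ℝ), ∃ M : ℝ, ∀ t ∈ Icc (0:ℝ) T, ∀ x, ‖z t x‖ ≤ M) →
          -- the linearized equation
          (∀ t > (0:ℝ), ∀ x,
            pdt z t x + pdx (fun s y => A (u s y) (z s y)) t x
              + (fderiv ℝ A (u t x) (z t x)) (pdx u t x)
              - (fderiv ℝ A (u t x) (pdx u t x)) (z t x) = pdx2 z t x) →
          -- initial data
          (∀ x ≤ (0:ℝ), ‖z 0 x‖ ≤ 1) → (∀ x > (0:ℝ), z 0 x = 0) →
          ∀ t ≥ (0:ℝ), ∀ x : ℝ,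
            ‖z t x‖ ≤ 2 * Real.exp (C * t +
              4 * MDA * (∫ s in (0:ℝ)..t, ⨆ x' : ℝ, ‖pdx u s x'‖) + t - x) := by
  set L : ℝ := (16 * (MA + 1)) ^ 2 with hL
  have hsqrt : √L = 16 * (MA + 1) := Real.sqrt_sq (by positivity)
  have hL0 : 0 < L := by positivity
  have hML : MA * (Real.pi / √L) ≤ 1 / 4 := by
    rw [hsqrt, ← mul_div_assoc, div_le_iff₀ (by positivity)]
    nlinarith [Real.pi_le_four]
  refine ⟨L + 1, by positivity, ?_⟩
  intro n A hA hAle MDA hDA u z hu hz hux hint hbdd heq hneg hpos t ht x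
  have hMDA : 0 ≤ MDA := (norm_nonneg (fderiv ℝ A 0)).trans (hDA 0)
  have hflux : ContDiffOn ℝ (⊤ : ℕ∞) (fun p : ℝ × ℝ => A (u p.1 p.2) (z p.1 p.2))
      (Ici (0 : ℝ) ×ˢ (univ : Set ℝ)) := (hA.comp_contDiffOn hu).clm_apply hz
  have h := fun i => IsHeatSolution.of_contDiffOn (v := fun s y => z s y i)
    (f := fun s y => A (u s y) (z s y) i) (contDiffOn_pi.1 hz i) (contDiffOn_pi.1 hflux i)
  have hsource : ∀ s > 0, ∀ y, (fun i => deriv (fun r => z r y i) s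
        + deriv (fun y => A (u s y) (z s y) i) y - deriv (deriv fun y => z s y i) y)
      = fderiv ℝ A (u s y) (pdx u s y) (z s y) - fderiv ℝ A (u s y) (z s y) (pdx u s y) := by
    intro s hs y
    have ht' : pdt z s y = fun i => deriv (fun r => z r y i) s :=
      deriv_pi fun i => ((h i).hasDerivAt_vt s hs y).differentiableAt
    have hf' : pdx (fun s y => A (u s y) (z s y)) s y
        = fun i => deriv (fun y => A (u s y) (z s y) i) y :=
      deriv_pi fun i => ((h i).hasDerivAt_fx s hs y).differentiableAt
    have hx' : pdx z s = fun y i => deriv (fun y => z s y i) y := funext fun y =>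
      deriv_pi fun i => ((h i).hasDerivAt_vx s hs y).differentiableAt
    have hxx' : pdx2 z s y = fun i => deriv (deriv fun y => z s y i) y := by
      change deriv (pdx z s) y = _
      rw [hx']
      exact deriv_pi fun i => ((h i).hasDerivAt_vxx s hs y).differentiableAt
    have := heq s hs y
    rw [ht', hf', hxx'] at this
    ext i
    have := congrFun this i
    simp only [Pi.add_apply, Pi.sub_apply] at this ⊢
    linarith
  obtain ⟨M', hM'⟩ := hbdd (t + 1) (by linarith)
  have key := norm_le_of_isHeatSolution h
    (V := fun s => 4 * MDA * ⨆ x' : ℝ, ‖pdx u s x'‖) hMA hL0 hML ht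
    (((hint (t + 1) (by linarith)).mono_set (by
      rw [uIcc_of_le ht, uIcc_of_le (by linarith)]
      exact Icc_subset_Icc_right (by linarith))).const_mul _)
    (fun s => mul_nonneg (by positivity) (Real.iSup_nonneg fun _ => norm_nonneg _))
    (fun s hs => hM' s ⟨hs.1, by linarith [hs.2]⟩)
    (fun s _ y => (A (u s y)).le_of_opNorm_le (hAle _) _)
    (fun s hs y => by
      rw [hsource s hs y]
      have hU := le_ciSup (hux s) y
      have h1 : ‖fderiv ℝ A (u s y) (pdx u s y) (z s y)‖ ≤ MDA * ‖pdx u s y‖ * ‖z s y‖ :=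
        ContinuousLinearMap.le_of_opNorm_le _
          (ContinuousLinearMap.le_of_opNorm_le _ (hDA _) _) _
      have h2 : ‖fderiv ℝ A (u s y) (z s y) (pdx u s y)‖ ≤ MDA * ‖z s y‖ * ‖pdx u s y‖ :=
        ContinuousLinearMap.le_of_opNorm_le _
          (ContinuousLinearMap.le_of_opNorm_le _ (hDA _) _) _
      calc _ ≤ _ := norm_sub_le _ _
        _ ≤ MDA * ‖pdx u s y‖ * ‖z s y‖ + MDA * ‖z s y‖ * ‖pdx u s y‖ := add_le_add h1 h2
        _ = 2 * MDA * ‖pdx u s y‖ * ‖z s y‖ := by ring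
        _ ≤ 2 * MDA * (⨆ x' : ℝ, ‖pdx u s x'‖) * ‖z s y‖ := by gcongr
        _ = _ := by ring)
    hneg hpos x
  rw [intervalIntegral.integral_const_mul] at key
  refine key.trans_eq ?_
  congr 2
  ring
end
end
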